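/- Given sets A_n ⊆ ℝ for n < ω, one can find sets B_n ⊆ A_n, pairwise disjoint, such that for every n the sets A_n and B_n have the same Lebesgue outer measure. -/

import Mathlib

open MeasureTheory

namespace GS

section

open MeasureTheory Set

/-- Exhaustion: a class of measurable sets closed under countable unions has an
essentially largest element. -/
lemma exhaust (ν : Measure ℝ) [IsFiniteMeasure ν] (p : Set ℝ → Prop) (h0 : p ∅)
    (hU : ∀ f : ℕ → Set ℝ, (∀ n, MeasurableSet (f n)) → (∀ n, p (f n)) → p (⋃ n, f n)) :
    ∃ E, MeasurableSet E ∧ p E ∧ ∀ E', MeasurableSet E' → p E' → ν (E' \ E) = 0 := by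
  classical
  let S : Set ENNReal := {t | ∃ E, MeasurableSet E ∧ p E ∧ ν E = t}
  have hSne : S.Nonempty := ⟨ν ∅, ∅, MeasurableSet.empty, h0, rfl⟩
  obtain ⟨u, -, hutend, huS⟩ := exists_seq_tendsto_sSup hSne (OrderTop.bddAbove S)
  choose F hFm hFp hFv using huS
  refine ⟨⋃ n, F n, MeasurableSet.iUnion hFm, hU F hFm hFp, ?_⟩
  intro E' hE'm hE'p
  have hle : ∀ n, u n ≤ ν (⋃ n, F n) := fun n => by
    rw [← hFv n]; exact measure_mono (subset_iUnion F n)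
  have hsup : sSup S ≤ ν (⋃ n, F n) := le_of_tendsto' hutend hle
  have hmem : ν ((⋃ n, F n) ∪ E') ∈ S := by
    refine ⟨_, (MeasurableSet.iUnion hFm).union hE'm, ?_, rfl⟩
    have := hU (fun n => if n = 0 then E' else F (n-1)) (by
      intro n; split_ifs; exacts [hE'm, hFm _]) (by
      intro n; split_ifs; exacts [hE'p, hFp _])
    convert this using 1
    ext x
    simp only [mem_union, mem_iUnion]
    constructor
    · rintro (⟨n, hn⟩ | h)
      · exact ⟨n+1, by simpa using hn⟩
      · exact ⟨0, by simpa using h⟩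
    · rintro ⟨n, hn⟩
      split_ifs at hn
      · exact Or.inr hn
      · exact Or.inl ⟨_, hn⟩
  have h1 : ν ((⋃ n, F n) ∪ E') ≤ ν (⋃ n, F n) := (le_sSup hmem).trans hsup
  have h2 := measure_union_add_inter (μ := ν) E' (MeasurableSet.iUnion hFm)
  have h3 : ν ((⋃ n, F n) ∪ E') = ν (⋃ n, F n) + ν (E' \ ⋃ n, F n) := by
    rw [← union_sdiff_self, measure_union' disjoint_sdiff_right (MeasurableSet.iUnion hFm)]
  rw [h3] at h1
  have hfin : ν (⋃ n, F n) ≠ ⊤ := measure_ne_top _ _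
  have := ENNReal.add_le_add_iff_left hfin (b := ν (E' \ ⋃ n, F n)) (c := 0)
  simpa using this.1 (by simpa using h1)

/-- The abstract situation to be refuted. -/
structure Sys (ν : Measure ℝ) (C : ℕ → Set ℝ) (Neg : Set ℝ → Prop) : Prop where
  mono : ∀ {A B : Set ℝ}, A ⊆ B → Neg B → Neg A
  iUnion : ∀ f : ℕ → Set ℝ, (∀ n, Neg (f n)) → Neg (⋃ n, f n)
  null : ∀ A, ν A = 0 → Neg A
  dense : ∀ Y, ¬ Neg Y → ∃ n E, MeasurableSet E ∧ ν (C n ∩ E) ≠ 0 ∧ ν ((C n ∩ E) \ Y) = 0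
  piece : ∀ n E, MeasurableSet E → ν (C n ∩ E) ≠ 0 → ¬ Neg (C n ∩ E)

namespace Sys
variable {ν : Measure ℝ} {C : ℕ → Set ℝ} {Neg : Set ℝ → Prop}

lemma empty (S : Sys ν C Neg) : Neg ∅ := S.null _ (by simp)

lemma iUnion' (S : Sys ν C Neg) {ι : Type*} [Countable ι] (f : ι → Set ℝ) (h : ∀ i, Neg (f i)) :
    Neg (⋃ i, f i) := by
  cases isEmpty_or_nonempty ι
  · simpa using S.empty
  · obtain ⟨e, he⟩ := exists_surjective_nat ι
    have := S.iUnion (fun n => f (e n)) (fun n => h _)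
    rwa [he.iUnion_comp f] at this

lemma union (S : Sys ν C Neg) {A B : Set ℝ} (hA : Neg A) (hB : Neg B) : Neg (A ∪ B) := by
  rw [union_eq_iUnion]
  exact S.iUnion' _ (by rintro (_|_) <;> assumption)

lemma exists_hull (S : Sys ν C Neg) [IsFiniteMeasure ν] (Y : Set ℝ) :
    ∃ H, MeasurableSet H ∧ Neg (Y \ H) ∧ ∀ E, MeasurableSet E → Neg (Y ∩ E) → ν (H ∩ E) = 0 := by
  obtain ⟨E, hE, hp, hmax⟩ := exhaust ν (fun E => Neg (Y ∩ E)) (by simpa using S.empty)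
    (by intro f _ hf; rw [inter_iUnion]; exact S.iUnion _ hf)
  refine ⟨Eᶜ, hE.compl, by simpa [sdiff_eq] using hp, fun E' hE' h => ?_⟩
  have := hmax E' hE' h
  rwa [inter_comm, ← sdiff_eq]

end Sys

open Classical in
/-- Essential hull of `Y` modulo `Neg`. -/
noncomputable def hull (ν : Measure ℝ) (Neg : Set ℝ → Prop) (Y : Set ℝ) : Set ℝ :=
  if h : ∃ H, MeasurableSet H ∧ Neg (Y \ H) ∧ ∀ E, MeasurableSet E → Neg (Y ∩ E) → ν (H ∩ E) = 0
  then h.choose else ∅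

namespace Sys
variable {ν : Measure ℝ} {C : ℕ → Set ℝ} {Neg : Set ℝ → Prop} [IsFiniteMeasure ν]

lemma hull_spec (S : Sys ν C Neg) (Y : Set ℝ) :
    MeasurableSet (hull ν Neg Y) ∧ Neg (Y \ hull ν Neg Y) ∧
      ∀ E, MeasurableSet E → Neg (Y ∩ E) → ν (hull ν Neg Y ∩ E) = 0 := by
  have h := S.exists_hull Y
  rw [hull, dif_pos h]
  exact h.choose_spec

lemma hull_meas (S : Sys ν C Neg) (Y : Set ℝ) : MeasurableSet (hull ν Neg Y) := (S.hull_spec Y).1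

lemma hull_diff (S : Sys ν C Neg) (Y : Set ℝ) : Neg (Y \ hull ν Neg Y) := (S.hull_spec Y).2.1

lemma hull_inter (S : Sys ν C Neg) {Y E : Set ℝ} (hE : MeasurableSet E) :
    Neg (Y ∩ E) ↔ ν (hull ν Neg Y ∩ E) = 0 := by
  refine ⟨(S.hull_spec Y).2.2 E hE, fun h => ?_⟩
  refine S.mono ?_ (S.union (S.hull_diff Y) (S.null _ h))
  intro x hx
  by_cases hh : x ∈ hull ν Neg Y
  · exact Or.inr ⟨hh, hx.2⟩
  · exact Or.inl ⟨hx.1, hh⟩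

/-- hull of a countable union is covered by hulls -/
lemma hull_iUnion (S : Sys ν C Neg) {ι : Type*} [Countable ι] (Y : Set ℝ) (f : ι → Set ℝ)
    (h : Y ⊆ ⋃ i, f i) : ∀ᵐ x ∂ν, x ∈ hull ν Neg Y → ∃ i, x ∈ hull ν Neg (Y ∩ f i) := by
  have hm : MeasurableSet (⋃ i, hull ν Neg (Y ∩ f i))ᶜ :=
    (MeasurableSet.iUnion fun i => S.hull_meas _).compl
  have : ν (hull ν Neg Y ∩ (⋃ i, hull ν Neg (Y ∩ f i))ᶜ) = 0 := by
    rw [← S.hull_inter hm]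
    refine S.mono ?_ (S.iUnion' _ (fun i => S.hull_diff (Y ∩ f i)))
    rintro x ⟨hx, hx2⟩
    obtain ⟨i, hi⟩ := mem_iUnion.1 (h hx)
    refine mem_iUnion.2 ⟨i, ⟨hx, hi⟩, fun hh => hx2 (mem_iUnion.2 ⟨i, hh⟩)⟩
  rw [ae_iff]
  convert this using 2
  ext x
  simp

lemma hull_mono (S : Sys ν C Neg) {Y Z : Set ℝ} (h : Y ⊆ Z) :
    ∀ᵐ x ∂ν, x ∈ hull ν Neg Y → x ∈ hull ν Neg Z := by
  have : ν (hull ν Neg Y ∩ (hull ν Neg Z)ᶜ) = 0 := by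
    rw [← S.hull_inter (S.hull_meas _).compl]
    refine S.mono ?_ (S.hull_diff Z)
    intro x hx
    exact ⟨h hx.1, hx.2⟩
  rw [ae_iff]
  convert this using 2
  ext x
  simp

end Sys
end

end GS

namespace GS

section

open MeasureTheory Set

/-- Step 1: the chain of null sets. -/
lemma Sys.chain {ν : Measure ℝ} [IsFiniteMeasure ν] (hν : ν ≪ volume)
    {C : ℕ → Set ℝ} {Neg : Set ℝ → Prop} (S : Sys ν C Neg) (hne : ¬ Neg univ) :
    ∃ (I : Type) (_ : LinearOrder I) (ρ : ℝ → I) (U : Set ℝ), ¬ Neg U ∧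
      (∀ i, ν {p | p ∈ U ∧ ρ p ≤ i} = 0) ∧
      (∀ (i : I) (f : I → Set ℝ), (∀ j, Neg (f j)) → Neg (⋃ j ∈ Iio i, f j)) := by
  classical
  -- the least cardinal of a family of negligible sets with non-negligible union
  let K : Set Cardinal.{0} := {c | ∃ (T : Type) (f : T → Set ℝ), Cardinal.mk T = c ∧
    (∀ t, Neg (f t)) ∧ ¬ Neg (⋃ t, f t)}
  have hK : K.Nonempty := by
    refine ⟨_, ℝ, fun x => {x}, rfl, fun x => S.null _ (hν (by simp)), ?_⟩
    rwa [show (⋃ t : ℝ, {t}) = univ from iUnion_of_singleton ℝ]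
  obtain ⟨T, f, hT, hf, hfU⟩ := csInf_mem hK
  set κ := sInf K with hκ
  let I := κ.ord.ToType
  have hI : Cardinal.mk I = Cardinal.mk T := by rw [hT]; exact Cardinal.mk_ord_toType κ
  obtain ⟨e⟩ := Cardinal.eq.1 hI
  let Y : I → Set ℝ := fun i => f (e i)
  have hY : ∀ i, Neg (Y i) := fun i => hf _
  have hYU : ¬ Neg (⋃ i, Y i) := by
    have : (⋃ i, Y i) = ⋃ t, f t := e.surjective.iUnion_comp f
    rwa [this]
  have hsmall : ∀ (i : I) (g : I → Set ℝ), (∀ j, Neg (g j)) → Neg (⋃ j ∈ Iio i, g j) := by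
    intro i g hg
    by_contra hcon
    have hmem : Cardinal.mk (Iio i) ∈ K := by
      refine ⟨Iio i, fun j => g j, rfl, fun j => hg j, ?_⟩
      rwa [← biUnion_eq_iUnion (Iio i) (fun j _ => g j)]
    exact absurd (Cardinal.mk_Iio_toType_ord_lt i) (not_lt.2 (csInf_le' hmem))
  let Pt : I → Set ℝ := fun i => ⋃ j ∈ Iic i, Y j
  have hPt : ∀ i, Neg (Pt i) := by
    intro i
    refine S.mono ?_ (S.union (hsmall i Y hY) (hY i))
    intro x hx
    simp only [Pt, mem_iUnion, mem_Iic] at hx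
    obtain ⟨j, hj, hx⟩ := hx
    rcases hj.lt_or_eq with h | h
    · exact Or.inl (mem_iUnion₂.2 ⟨j, h, hx⟩)
    · exact Or.inr (h ▸ hx)
  have hPmono : Monotone Pt := fun i j hij =>
    biUnion_subset_biUnion_left (Iic_subset_Iic.2 hij)
  have hYP : ∀ i, Y i ⊆ Pt i := fun i x hx => mem_iUnion₂.2 ⟨i, mem_Iic.2 le_rfl, hx⟩
  have hPU : (⋃ i, Pt i) = ⋃ i, Y i := by
    apply subset_antisymm
    · exact iUnion_subset fun i => iUnion₂_subset fun j _ => subset_iUnion Y j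
    · exact iUnion_mono hYP
  have hbdd : ∀ (J : Type) [Countable J] (s : J → I), ∃ i, ∀ k, s k ≤ i := by
    intro J _ s
    by_contra! hcon
    apply hYU
    refine S.mono ?_ (S.iUnion' (fun k => Pt (s k)) (fun k => hPt _))
    refine iUnion_subset fun i => ?_
    obtain ⟨k, hk⟩ := hcon i
    exact ((hYP i).trans (hPmono hk.le)).trans (subset_iUnion (fun k => Pt (s k)) k)
  have : Nonempty I := by
    by_contra h
    rw [not_nonempty_iff] at h
    apply hYU; simpa using S.empty
  -- stabilisation
  have hst : ∀ n, ∃ s : ℕ → I, ∀ i, (∀ k, s k ≤ i) →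
      ν (C n ∩ Pt i) = sSup (range fun i => ν (C n ∩ Pt i)) := by
    intro n
    obtain ⟨u, -, hut, hur⟩ := exists_seq_tendsto_sSup
      (range_nonempty fun i => ν (C n ∩ Pt i)) (OrderTop.bddAbove _)
    choose s hs using hur
    refine ⟨s, fun i hi => le_antisymm (le_sSup (mem_range_self i)) ?_⟩
    refine le_of_tendsto' hut fun k => ?_
    rw [← hs k]
    exact measure_mono (inter_subset_inter_right _ (hPmono (hi k)))
  choose s hs using hst
  obtain ⟨i0, hi0⟩ := hbdd (ℕ × ℕ) (fun k => s k.1 k.2)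
  have hstab : ∀ n i, i0 ≤ i → ν (C n ∩ Pt i) = ν (C n ∩ Pt i0) := by
    intro n i hi
    rw [hs n i (fun k => (hi0 (n, k)).trans hi), hs n i0 (fun k => hi0 (n, k))]
  -- a piece inside the union, missing `Pt i0`
  have hnn : ¬ Neg ((⋃ i, Y i) \ Pt i0) := by
    intro h
    apply hYU
    refine S.mono ?_ (S.union h (hPt i0))
    intro x hx
    by_cases hh : x ∈ Pt i0
    · exact Or.inr hh
    · exact Or.inl ⟨hx, hh⟩
  obtain ⟨n, E, hE, hpos, hsub⟩ := S.dense _ hnn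
  have hnull : ∀ i, ν (C n ∩ E ∩ Pt i) = 0 := by
    have key : ∀ i, i0 ≤ i → ν (C n ∩ E ∩ Pt i) = 0 := by
      intro i hi
      have h0 : ν (C n ∩ Pt i0 ∩ E) = 0 := by
        refine measure_mono_null ?_ hsub
        rintro x ⟨⟨h1, h2⟩, h3⟩
        exact ⟨⟨h1, h3⟩, fun h => h.2 h2⟩
      have h1 := measure_inter_add_sdiff (μ := ν) (C n ∩ Pt i) hE
      have h2 := measure_inter_add_sdiff (μ := ν) (C n ∩ Pt i0) hE
      -- hulls
      set G := toMeasurable ν (C n ∩ Pt i)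
      have hG1 : ν (toMeasurable ν (C n ∩ Pt i) ∩ toMeasurable ν (C n ∩ Pt i0)) = ν (C n ∩ Pt i0) := by
        apply le_antisymm
        · exact (measure_mono inter_subset_right).trans (measure_toMeasurable _).le
        · refine measure_mono fun x hx => ⟨subset_toMeasurable _ _ ?_, subset_toMeasurable _ _ hx⟩
          exact ⟨hx.1, hPmono hi hx.2⟩
      have hG2 := measure_inter_add_sdiff (μ := ν) (toMeasurable ν (C n ∩ Pt i))
        (measurableSet_toMeasurable ν (C n ∩ Pt i0))
      rw [hG1, measure_toMeasurable, hstab n i hi] at hG2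
      have hG3 : ν (toMeasurable ν (C n ∩ Pt i) \ toMeasurable ν (C n ∩ Pt i0)) = 0 := by
        have hfin : ν (C n ∩ Pt i0) ≠ ⊤ := measure_ne_top _ _
        have := ENNReal.add_le_add_iff_left hfin
          (b := ν (toMeasurable ν (C n ∩ Pt i) \ toMeasurable ν (C n ∩ Pt i0))) (c := 0)
        simpa using this.1 (by simpa using hG2.le)
      have hG4 : ν (toMeasurable ν (C n ∩ Pt i0) ∩ E) = 0 := by
        rw [Measure.measure_toMeasurable_inter hE (measure_ne_top _ _)]; exact h0
      refine measure_mono_null ?_ (measure_union_null hG3 hG4)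
      rintro x ⟨⟨hx1, hx2⟩, hx3⟩
      by_cases hh : x ∈ toMeasurable ν (C n ∩ Pt i0)
      · exact Or.inr ⟨hh, hx2⟩
      · exact Or.inl ⟨subset_toMeasurable _ _ ⟨hx1, hx3⟩, hh⟩
    intro i
    rcases le_total i0 i with h | h
    · exact key i h
    · exact measure_mono_null (inter_subset_inter_right _ (hPmono h)) (key i0 le_rfl)
  have hwf : WellFounded (α := I) (· < ·) := wellFounded_lt
  let U : Set ℝ := C n ∩ E ∩ ⋃ i, Y i
  let ρ : ℝ → I := fun p => if h : {i | p ∈ Pt i}.Nonempty then hwf.min _ h else i0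
  refine ⟨I, inferInstance, ρ, U, ?_, ?_, hsmall⟩
  · intro h
    apply S.piece n E hE hpos
    refine S.mono ?_ (S.union h (S.null _ hsub))
    intro x hx
    by_cases hh : x ∈ ⋃ i, Y i
    · exact Or.inl ⟨hx, hh⟩
    · exact Or.inr ⟨hx, fun h => hh h.1⟩
  · intro i
    refine measure_mono_null ?_ (hnull i)
    rintro p ⟨⟨hp1, hp2⟩, hp3⟩
    refine ⟨hp1, ?_⟩
    rw [← hPU] at hp2
    obtain ⟨j, hj⟩ := mem_iUnion.1 hp2
    have hne : {i | p ∈ Pt i}.Nonempty := ⟨j, hj⟩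
    have h1 : ρ p = hwf.min _ hne := dif_pos hne
    have h2 : p ∈ Pt (ρ p) := by rw [h1]; exact hwf.min_mem _ hne
    exact hPmono hp3 h2

end

end GS

namespace GS

section

open MeasureTheory Set

/-- Borel codes for null sets. -/
lemma exists_codes (ν : Measure ℝ) [IsFiniteMeasure ν] :
    ∃ G : (ℕ → Bool) → Set ℝ, MeasurableSet {q : (ℕ → Bool) × ℝ | q.2 ∈ G q.1} ∧
      ∀ A, ν A = 0 → ∃ b, A ⊆ G b ∧ ν (G b) = 0 := by
  classical
  obtain ⟨V, hV⟩ := (TopologicalSpace.countable_countableBasis ℝ).exists_eq_range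
    (by
      obtain ⟨v, hv, -⟩ := (TopologicalSpace.isBasis_countableBasis ℝ).exists_subset_of_mem_open
        (mem_univ (0 : ℝ)) isOpen_univ
      exact ⟨v, hv⟩)
  have hbas := TopologicalSpace.isBasis_countableBasis ℝ
  rw [hV] at hbas
  refine ⟨fun b => ⋂ m, ⋃ k, {y | b (Nat.pair m k) = true ∧ y ∈ V k}, ?_, ?_⟩
  · have : {q : (ℕ → Bool) × ℝ | q.2 ∈ ⋂ m, ⋃ k, {y | q.1 (Nat.pair m k) = true ∧ y ∈ V k}} =
        ⋂ m, ⋃ k, {q : (ℕ → Bool) × ℝ | q.1 (Nat.pair m k) = true ∧ q.2 ∈ V k} := by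
      ext q; simp
    rw [this]
    refine MeasurableSet.iInter fun m => MeasurableSet.iUnion fun k => MeasurableSet.inter ?_ ?_
    · have : Measurable fun q : (ℕ → Bool) × ℝ => q.1 (Nat.pair m k) :=
        (measurable_pi_apply (Nat.pair m k)).comp measurable_fst
      exact this (measurableSet_singleton true)
    · exact measurable_snd (hbas.isOpen (mem_range_self k)).measurableSet
  · intro A hA
    have h1 : ∀ m : ℕ, ∃ O ⊇ A, IsOpen O ∧ ν O < ((m : ENNReal) + 1)⁻¹ := fun m =>
      Set.exists_isOpen_lt_of_lt A _ (by rw [hA]; simp [ENNReal.inv_pos])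
    choose O hAO hO hOm using h1
    let b : ℕ → Bool := fun t => decide (V t.unpair.2 ⊆ O t.unpair.1)
    have hG : ∀ m, (⋃ k, {y | b (Nat.pair m k) = true ∧ y ∈ V k}) = O m := by
      intro m
      ext y
      simp only [mem_iUnion, mem_ofPred_eq, b, Nat.unpair_pair, decide_eq_true_eq]
      constructor
      · rintro ⟨k, h1, h2⟩; exact h1 h2
      · intro hy
        obtain ⟨v, ⟨k, rfl⟩, hv, hvO⟩ := hbas.exists_subset_of_mem_open hy (hO m)
        exact ⟨k, hvO, hv⟩
    refine ⟨b, subset_iInter fun m => by rw [hG]; exact hAO m, ?_⟩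
    refine le_antisymm (ENNReal.le_of_forall_pos_le_add ?_) bot_le
    intro ε hε _
    obtain ⟨m, hm⟩ := ENNReal.exists_inv_nat_lt (a := (ε : ENNReal)) (by simpa using hε.ne')
    rw [zero_add]
    refine le_trans ?_ hm.le
    refine (measure_mono (iInter_subset _ m)).trans ?_
    rw [hG]
    refine (hOm m).le.trans ?_
    exact ENNReal.inv_le_inv.2 le_self_add

/-- The situation after Step 1. -/
structure Ctx (ν : Measure ℝ) (C : ℕ → Set ℝ) (Neg : Set ℝ → Prop) (I : Type) [LinearOrder I]
    (ρ : ℝ → I) (U : Set ℝ) : Prop where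
  S : Sys ν C Neg
  ac : ν ≪ volume
  pos : ¬ Neg U
  null : ∀ i, ν {p | p ∈ U ∧ ρ p ≤ i} = 0
  small : ∀ (i : I) (f : I → Set ℝ), (∀ j, Neg (f j)) → Neg (⋃ j ∈ Iio i, f j)

variable {ν : Measure ℝ} [IsFiniteMeasure ν] {C : ℕ → Set ℝ} {Neg : Set ℝ → Prop}
  {I : Type} [LinearOrder I] {ρ : ℝ → I} {U : Set ℝ}

lemma Ctx.perfect (X : Ctx ν C Neg I ρ U) :
    ∃ b : I → ℕ → Bool, ∀ Y ⊆ U, ¬ Neg Y → ∀ B : ℝ → ℕ → Bool, Measurable B →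
      ¬ Neg {p | p ∈ Y ∧ b (ρ p) ≠ B p} := by
  obtain ⟨G, hGm, hG⟩ := exists_codes ν
  choose b hb hb0 using fun i => hG _ (X.null i)
  refine ⟨b, fun Y hYU hY B hB hneg => ?_⟩
  have S := X.S
  have hZm : MeasurableSet {q : ℝ × ℝ | q.2 ∈ G (B q.1)} :=
    (Measurable.prodMk (hB.comp measurable_fst) measurable_snd) hGm
  set H := hull ν Neg Y
  have hHm : MeasurableSet H := S.hull_meas Y
  have hH0 : ν H ≠ 0 := by
    intro h
    apply hY
    have := (S.hull_inter (Y := Y) MeasurableSet.univ).2 (by simpa using h)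
    simpa using this
  -- almost all codes are null
  have hE1 : MeasurableSet {x | ν (G (B x)) ≠ 0} := by
    have : Measurable fun x => ν (Prod.mk x ⁻¹' {q : ℝ × ℝ | q.2 ∈ G (B q.1)}) :=
      measurable_measure_prodMk_left hZm
    exact (this (measurableSet_singleton 0)).compl
  have hE2 : ν (H ∩ {x | ν (G (B x)) ≠ 0}) = 0 := by
    rw [← S.hull_inter hE1]
    refine S.mono ?_ hneg
    rintro p ⟨hp, hp2⟩
    refine ⟨hp, fun h => hp2 ?_⟩
    rw [← h]; exact hb0 _
  have hE3 : ∀ y ∈ U, ν (H ∩ {x | y ∈ G (B x)}) ≠ 0 := by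
    intro y hy h
    have hm : MeasurableSet {x | y ∈ G (B x)} := by
      have : MeasurableSet ((fun x => (x, y)) ⁻¹' {q : ℝ × ℝ | q.2 ∈ G (B q.1)}) :=
        measurable_prodMk_right hZm
      exact this
    have h2 : ν (H ∩ {x | y ∈ G (B x)}ᶜ) = 0 := by
      rw [← S.hull_inter hm.compl]
      refine S.mono ?_ (S.union hneg (S.null _ (X.null (ρ y))))
      rintro p ⟨hp, hp2⟩
      by_cases hle : ρ p ≤ ρ y
      · exact Or.inr ⟨hYU hp, hle⟩
      · refine Or.inl ⟨hp, fun he => hp2 ?_⟩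
        show y ∈ G (B p)
        rw [← he]
        exact hb _ ⟨hy, (not_le.1 hle).le⟩
    apply hH0
    refine measure_mono_null ?_ (measure_union_null h h2)
    intro x hx
    by_cases hh : y ∈ G (B x)
    · exact Or.inl ⟨hx, hh⟩
    · exact Or.inr ⟨hx, hh⟩
  -- Fubini
  have hW : MeasurableSet {q : ℝ × ℝ | q.1 ∈ H ∧ q.2 ∈ G (B q.1)} :=
    (measurable_fst hHm).inter hZm
  have h1 : (ν.prod ν) {q : ℝ × ℝ | q.1 ∈ H ∧ q.2 ∈ G (B q.1)} = 0 := by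
    rw [Measure.measure_prod_null hW]
    have : ∀ᵐ x ∂ν, ¬ (x ∈ H ∩ {x | ν (G (B x)) ≠ 0}) :=
      measure_eq_zero_iff_ae_notMem.1 hE2
    filter_upwards [this] with x hx
    by_cases hxH : x ∈ H
    · have h0 : ν (G (B x)) = 0 := by
        by_contra h; exact hx ⟨hxH, h⟩
      exact measure_mono_null (fun y hy => hy.2) h0
    · have : Prod.mk x ⁻¹' {q : ℝ × ℝ | q.1 ∈ H ∧ q.2 ∈ G (B q.1)} = ∅ := by
        ext y; simp [hxH]
      simp [this]
  have hsw : (ν.prod ν) (Prod.swap ⁻¹' {q : ℝ × ℝ | q.1 ∈ H ∧ q.2 ∈ G (B q.1)}) = 0 := by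
    rw [← Measure.prod_swap, Measure.map_apply measurable_swap] at h1
    · exact h1
    · exact hW
  have h2 := Measure.measure_ae_null_of_prod_null hsw
  apply X.pos
  apply S.null
  rw [Filter.EventuallyEq, ae_iff] at h2
  refine measure_mono_null ?_ h2
  intro y hy
  exact hE3 y hy

lemma Ctx.split (X : Ctx ν C Neg I ρ U) :
    ∃ b : I → ℕ → Bool, ∀ Y ⊆ U, ∀ᵐ x ∂ν, x ∈ hull ν Neg Y →
      ∃ k, ∀ v, x ∈ hull ν Neg (Y ∩ {p | b (ρ p) k = v}) := by
  classical
  obtain ⟨b, hb⟩ := X.perfect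
  have S := X.S
  refine ⟨b, fun Y hYU => ?_⟩
  set D : Set ℝ := {x | ∀ k, ¬ ∀ v, x ∈ hull ν Neg (Y ∩ {p | b (ρ p) k = v})} with hD
  have hDm : MeasurableSet D := by
    have : D = ⋂ k, (⋂ v, hull ν Neg (Y ∩ {p | b (ρ p) k = v}))ᶜ := by
      ext x; simp [D, imp_iff_not_or]
    rw [this]
    exact MeasurableSet.iInter fun k => (MeasurableSet.iInter fun v => S.hull_meas _).compl
  have key : ν (hull ν Neg Y ∩ D) = 0 := by
    rw [← S.hull_inter hDm]
    by_contra hpos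
    let B : ℝ → ℕ → Bool := fun x k => decide (x ∈ hull ν Neg (Y ∩ {p | b (ρ p) k = true}))
    have hB : Measurable B := by
      refine measurable_pi_iff.2 fun k => ?_
      exact measurable_to_bool (by
        convert S.hull_meas (Y ∩ {p | b (ρ p) k = true}) using 1
        ext x; simp [B])
    refine hb (Y ∩ D) (fun x hx => hYU hx.1) hpos B hB ?_
    refine S.mono ?_ (S.iUnion' (fun q : ℕ × Bool => (Y ∩ {p | b (ρ p) q.1 = q.2}) \
      hull ν Neg (Y ∩ {p | b (ρ p) q.1 = q.2})) (fun q => S.hull_diff _))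
    rintro p ⟨⟨hpY, hpD⟩, hne⟩
    by_contra hcon
    simp only [mem_iUnion, not_exists] at hcon
    have h1 : ∀ k, p ∈ hull ν Neg (Y ∩ {p' | b (ρ p') k = b (ρ p) k}) := by
      intro k
      by_contra h
      exact hcon (k, b (ρ p) k) ⟨⟨hpY, rfl⟩, h⟩
    apply hne
    funext k
    have h2 := h1 k
    have h3 := hpD k
    cases hbk : b (ρ p) k with
    | true =>
      rw [hbk] at h2
      simp [B, h2]
    | false =>
      rw [hbk] at h2
      have : p ∉ hull ν Neg (Y ∩ {p | b (ρ p) k = true}) := by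
        intro h
        exact h3 (by rintro (_|_) <;> assumption)
      simp [B, this]
  rw [ae_iff]
  refine measure_mono_null ?_ key
  intro x hx
  simp only [mem_ofPred_eq, Classical.not_imp, not_exists] at hx
  exact ⟨hx.1, hx.2⟩

end

end GS

namespace GS

section

open MeasureTheory Set

lemma count_colorings {S : Type} [Fintype S] [DecidableEq S] (T : Finset S) (w : Bool) :
    (Finset.univ.filter fun l : S → Bool => ∀ s ∈ T, l s = w).card * 2 ^ T.card
      = Fintype.card (S → Bool) := by
  classical
  have h1 : (Finset.univ.filter fun l : S → Bool => ∀ s ∈ T, l s = w) =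
      Fintype.piFinset (fun s => if s ∈ T then ({w} : Finset Bool) else Finset.univ) := by
    ext l
    simp only [Finset.mem_filter, Finset.mem_univ, true_and, Fintype.mem_piFinset]
    refine forall_congr' fun s => ?_
    split_ifs with h <;> simp [h]
  rw [h1, Fintype.card_piFinset]
  have h2 : (2 : ℕ) ^ T.card = ∏ s : S, if s ∈ T then 2 else 1 := by
    rw [Finset.prod_ite_mem]; simp
  rw [h2, ← Finset.prod_mul_distrib, Fintype.card_fun, ← Finset.card_univ (α := S),
    ← Finset.prod_const]
  refine Finset.prod_congr rfl fun s _ => ?_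
  split_ifs <;> simp

lemma good_coloring (ν : Measure ℝ) [IsFiniteMeasure ν] {S ι : Type} [Fintype S] [Fintype ι]
    (A : ι → ℝ → Finset S) (hA : ∀ i s, MeasurableSet {x | s ∈ A i x}) (N : ℕ) :
    ∃ l : S → Bool, ∀ i v, ν {x | N ≤ (A i x).card ∧ ∀ s ∈ A i x, l s = v} * 2 ^ N ≤
      2 * Fintype.card ι * ν univ := by
  classical
  have hcard : ∀ i, Measurable fun x => (A i x).card := by
    intro i
    have : (fun x => (A i x).card) = fun x => ∑ s : S, if s ∈ A i x then 1 else 0 := by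
      funext x; simp
    rw [this]
    exact Finset.measurable_sum _ fun s _ => Measurable.ite (hA i s) measurable_const
      measurable_const
  set Bad : ι → Bool → (S → Bool) → Set ℝ := fun i v l =>
    {x | N ≤ (A i x).card ∧ ∀ s ∈ A i x, l s = v} with hBad
  have hBm : ∀ i v l, MeasurableSet (Bad i v l) := by
    intro i v l
    have : Bad i v l = {x | N ≤ (A i x).card} ∩ ⋂ s : S, {x | s ∈ A i x → l s = v} := by
      ext x; simp [Bad]
    rw [this]
    refine (hcard i (measurableSet_Ici (a := N))).inter (MeasurableSet.iInter fun s => ?_)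
    by_cases h : l s = v
    · simp [h]
    · have : {x | s ∈ A i x → l s = v} = {x | s ∈ A i x}ᶜ := by
        ext x; simp [h]
      rw [this]; exact (hA i s).compl
  have hsum : ∀ i v, (∑ l : S → Bool, ν (Bad i v l)) * 2 ^ N ≤
      Fintype.card (S → Bool) * ν univ := by
    intro i v
    have : ∀ l, ν (Bad i v l) = ∫⁻ x, (Bad i v l).indicator 1 x ∂ν := fun l =>
      (lintegral_indicator_one (hBm i v l)).symm
    simp_rw [this]
    rw [← lintegral_finsetSum _ (fun l _ => measurable_one.indicator (hBm i v l)),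
      ← lintegral_mul_const _ (Finset.measurable_sum _ fun l _ =>
        measurable_one.indicator (hBm i v l))]
    rw [← lintegral_const]
    refine lintegral_mono fun x => ?_
    by_cases hN : N ≤ (A i x).card
    · have h1 : (∑ l : S → Bool, (Bad i v l).indicator (1 : ℝ → ENNReal) x) =
          ((Finset.univ.filter fun l : S → Bool => ∀ s ∈ A i x, l s = v).card : ENNReal) := by
        rw [Finset.card_filter]
        push_cast
        refine Finset.sum_congr rfl fun l _ => ?_
        simp [indicator, Bad, hN]
      rw [h1, ← count_colorings (A i x) v]
      push_cast
      gcongr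
      exact one_le_two
    · have h1 : (∑ l : S → Bool, (Bad i v l).indicator (1 : ℝ → ENNReal) x) = 0 := by
        refine Finset.sum_eq_zero fun l _ => ?_
        simp [indicator, Bad, hN]
      rw [h1]; simp
  by_contra hcon
  push Not at hcon
  have hlt : ∑ l : S → Bool, (2 * Fintype.card ι * ν univ) <
      ∑ l : S → Bool, ∑ i, ∑ v, ν (Bad i v l) * 2 ^ N := by
    refine ENNReal.sum_lt_sum_of_nonempty Finset.univ_nonempty fun l _ => ?_
    obtain ⟨i, v, h⟩ := hcon l
    refine h.trans_le ?_
    refine le_trans ?_ (Finset.single_le_sum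
      (f := fun i => ∑ v, ν (Bad i v l) * 2 ^ N) (fun _ _ => bot_le) (Finset.mem_univ i))
    exact Finset.single_le_sum
      (f := fun v => ν (Bad i v l) * 2 ^ N) (fun _ _ => bot_le) (Finset.mem_univ v)
  refine absurd hlt (not_lt.2 ?_)
  rw [Finset.sum_comm]
  have : ∀ i : ι, ∑ l : S → Bool, ∑ v, ν (Bad i v l) * 2 ^ N ≤
      2 * (Fintype.card (S → Bool) * ν univ) := by
    intro i
    rw [Finset.sum_comm]
    simp_rw [← Finset.sum_mul]
    rw [Finset.sum_mul]
    refine (Finset.sum_le_sum fun v _ => hsum i v).trans ?_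
    simp
  refine (Finset.sum_le_sum fun i _ => this i).trans ?_
  simp only [Finset.sum_const, Finset.card_univ, nsmul_eq_mul]
  apply le_of_eq
  ring

variable {ν : Measure ℝ} [IsFiniteMeasure ν] {C : ℕ → Set ℝ} {Neg : Set ℝ → Prop}

/-- refining a set by a finite valued function -/
lemma Sys.refine_hull (S : Sys ν C Neg) {T : Type} [Countable T] (q : ℝ → T) {Y Z : Set ℝ}
    (hZ : Z ⊆ Y) (P : T → Prop) (hP : ∀ p ∈ Z, P (q p)) :
    ∀ᵐ x ∂ν, x ∈ hull ν Neg Z → ∃ s, P s ∧ x ∈ hull ν Neg (Y ∩ {p | q p = s}) := by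
  have h1 := S.hull_iUnion Z (fun s : {s // P s} => {p | q p = s.1}) (by
    intro p hp
    exact mem_iUnion.2 ⟨⟨q p, hP p hp⟩, rfl⟩)
  have h2 : ∀ᵐ x ∂ν, ∀ s : T, x ∈ hull ν Neg (Z ∩ {p | q p = s}) →
      x ∈ hull ν Neg (Y ∩ {p | q p = s}) := by
    rw [ae_all_iff]
    intro s
    exact S.hull_mono (inter_subset_inter_left _ hZ)
  filter_upwards [h1, h2] with x h1 h2 hx
  obtain ⟨s, hs⟩ := h1 hx
  exact ⟨s.1, s.2, h2 _ hs⟩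

/-- initial segment of length `K` -/
def pre (K : ℕ) (c : ℕ → Bool) : Fin K → Bool := fun k => c k

open Classical in
/-- the nodes of level `K` of the tree of `Y` at `x` -/
noncomputable def node (ν : Measure ℝ) (Neg : Set ℝ → Prop) (c : ℝ → ℕ → Bool) (Y : Set ℝ) (K : ℕ)
    (x : ℝ) : Finset (Fin K → Bool) :=
  Finset.univ.filter fun s => x ∈ hull ν Neg (Y ∩ {p | pre K (c p) = s})

lemma mem_node {c : ℝ → ℕ → Bool} {Y : Set ℝ} {K : ℕ} {x : ℝ} {s : Fin K → Bool} :
    s ∈ node ν Neg c Y K x ↔ x ∈ hull ν Neg (Y ∩ {p | pre K (c p) = s}) := by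
  simp [node]

lemma Sys.growth (S : Sys ν C Neg) (c : ℝ → ℕ → Bool) (Y : Set ℝ)
    (hc : ∀ Z ⊆ Y, ∀ᵐ x ∂ν, x ∈ hull ν Neg Z →
      ∃ k, ∀ v, x ∈ hull ν Neg (Z ∩ {p | c p k = v})) :
    ∀ᵐ x ∂ν, x ∈ hull ν Neg Y → ∀ N, ∃ K₀, ∀ K ≥ K₀, N ≤ (node ν Neg c Y K x).card := by
  classical
  let Y' : (K : ℕ) → (Fin K → Bool) → Set ℝ := fun K s => Y ∩ {p | pre K (c p) = s}
  have F0 : ∀ᵐ x ∂ν, ∀ K, x ∈ hull ν Neg Y → ∃ s, s ∈ node ν Neg c Y K x := by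
    rw [ae_all_iff]; intro K
    filter_upwards [S.refine_hull (fun p => pre K (c p)) (Subset.refl Y) (fun _ => True)
      (by simp)] with x h hx
    obtain ⟨s, -, hs⟩ := h hx
    exact ⟨s, mem_node.2 hs⟩
  have F1 : ∀ᵐ x ∂ν, ∀ K K', ∀ h : K ≤ K', ∀ s ∈ node ν Neg c Y K x,
      ∃ s' ∈ node ν Neg c Y K' x, s' ∘ Fin.castLE h = s := by
    simp only [ae_all_iff]; intro K K' h s
    filter_upwards [S.refine_hull (fun p => pre K' (c p)) (inter_subset_left : Y' K s ⊆ Y)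
      (fun s' => s' ∘ Fin.castLE h = s) (by rintro p ⟨-, rfl⟩; rfl)] with x hx hs
    obtain ⟨s', h1, h2⟩ := hx (mem_node.1 hs)
    exact ⟨s', mem_node.2 h2, h1⟩
  have F2 : ∀ᵐ x ∂ν, ∀ K, ∀ s ∈ node ν Neg c Y K x, ∃ k, ∀ v,
      x ∈ hull ν Neg (Y' K s ∩ {p | c p k = v}) := by
    simp only [ae_all_iff]; intro K s
    filter_upwards [hc (Y' K s) inter_subset_left] with x h hx
    exact h (mem_node.1 hx)
  have F3 : ∀ᵐ x ∂ν, ∀ K K', ∀ h : K ≤ K', ∀ s : Fin K → Bool, ∀ k, ∀ hk : k < K', ∀ v,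
      x ∈ hull ν Neg (Y' K s ∩ {p | c p k = v}) →
      ∃ s' ∈ node ν Neg c Y K' x, s' ∘ Fin.castLE h = s ∧ s' ⟨k, hk⟩ = v := by
    simp only [ae_all_iff]; intro K K' h s k hk v
    filter_upwards [S.refine_hull (fun p => pre K' (c p))
      (inter_subset_left.trans inter_subset_left : Y' K s ∩ {p | c p k = v} ⊆ Y)
      (fun s' => s' ∘ Fin.castLE h = s ∧ s' ⟨k, hk⟩ = v)
      (by rintro p ⟨⟨-, rfl⟩, rfl⟩; exact ⟨rfl, rfl⟩)] with x hx hs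
    obtain ⟨s', h1, h2⟩ := hx hs
    exact ⟨s', mem_node.2 h2, h1⟩
  filter_upwards [F0, F1, F2, F3] with x F0 F1 F2 F3 hx
  have mono : ∀ K K', K ≤ K' → (node ν Neg c Y K x).card ≤ (node ν Neg c Y K' x).card := by
    intro K K' h
    refine (Finset.card_le_card (t := (node ν Neg c Y K' x).image fun s' => s' ∘ Fin.castLE h)
      ?_).trans Finset.card_image_le
    intro s hs
    obtain ⟨s', h1, h2⟩ := F1 K K' h s hs
    exact Finset.mem_image.2 ⟨s', h1, h2⟩
  have grow : ∀ N, ∃ K, N ≤ (node ν Neg c Y K x).card := by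
    intro N
    induction N with
    | zero => exact ⟨0, Nat.zero_le _⟩
    | succ N ih =>
      obtain ⟨K, hK⟩ := ih
      obtain ⟨s, hs⟩ := F0 K hx
      obtain ⟨k, hk⟩ := F2 K s hs
      have h : K ≤ max K (k+1) := le_max_left _ _
      have hk' : k < max K (k+1) := lt_of_lt_of_le (Nat.lt_succ_self k) (le_max_right _ _)
      obtain ⟨s1, h1, h1s, h1v⟩ := F3 K _ h s k hk' true (hk true)
      obtain ⟨s2, h2, h2s, h2v⟩ := F3 K _ h s k hk' false (hk false)
      have hne : s2 ≠ s1 := by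
        rintro rfl; rw [h1v] at h2v; cases h2v
      refine ⟨max K (k+1), ?_⟩
      have := Finset.card_erase_add_one h1
      rw [← this]
      refine Nat.succ_le_succ (hK.trans ?_)
      refine (Finset.card_le_card (t := ((node ν Neg c Y (max K (k+1)) x).erase s1).image
        fun s' => s' ∘ Fin.castLE h) ?_).trans Finset.card_image_le
      intro t ht
      obtain ⟨t', ht1, ht2⟩ := F1 K _ h t ht
      by_cases htt : t' = s1
      · refine Finset.mem_image.2 ⟨s2, Finset.mem_erase.2 ⟨hne, h2⟩, ?_⟩
        rw [← ht2, htt, h1s, h2s]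
      · exact Finset.mem_image.2 ⟨t', Finset.mem_erase.2 ⟨htt, ht1⟩, ht2⟩
  intro N
  obtain ⟨K, hK⟩ := grow N
  exact ⟨K, fun K' h => hK.trans (mono K K' h)⟩

variable {I : Type} [LinearOrder I] {ρ : ℝ → I} {U : Set ℝ}

lemma measurable_node_card (S : Sys ν C Neg) (c : ℝ → ℕ → Bool) (Y : Set ℝ) (K : ℕ) :
    Measurable fun x => (node ν Neg c Y K x).card := by
  classical
  have : (fun x => (node ν Neg c Y K x).card) = fun x => ∑ s : Fin K → Bool,
      if s ∈ node ν Neg c Y K x then 1 else 0 := by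
    funext x; simp
  rw [this]
  refine Finset.measurable_sum _ fun s _ => Measurable.ite ?_ measurable_const measurable_const
  simp only [mem_node]
  exact S.hull_meas _

lemma Sys.level (S : Sys ν C Neg) (c : ℝ → ℕ → Bool) (Y : Set ℝ)
    (hc : ∀ Z ⊆ Y, ∀ᵐ x ∂ν, x ∈ hull ν Neg Z →
      ∃ k, ∀ v, x ∈ hull ν Neg (Z ∩ {p | c p k = v})) (N : ℕ) (ε : ENNReal) (hε : ε ≠ 0) :
    ∃ K₀, ∀ K ≥ K₀, ν {x | x ∈ hull ν Neg Y ∧ (node ν Neg c Y K x).card < N} ≤ ε := by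
  have hg := S.growth c Y hc
  let D : ℕ → Set ℝ := fun K₀ => {x | x ∈ hull ν Neg Y ∧
    ∃ K ≥ K₀, (node ν Neg c Y K x).card < N}
  have hDm : ∀ K₀, MeasurableSet (D K₀) := by
    intro K₀
    have : D K₀ = hull ν Neg Y ∩ ⋃ K, ⋃ (_ : K ≥ K₀), {x | (node ν Neg c Y K x).card < N} := by
      ext x; simp [D]
    rw [this]
    refine (S.hull_meas _).inter (MeasurableSet.iUnion fun K => MeasurableSet.iUnion fun _ => ?_)
    exact measurable_node_card S c Y K (measurableSet_Iio (a := N))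
  have hDa : Antitone D := by
    intro K K' h x hx
    obtain ⟨h1, K1, h2, h3⟩ := hx
    exact ⟨h1, K1, h.trans h2, h3⟩
  have h0 : ν (⋂ K, D K) = 0 := by
    rw [measure_eq_zero_iff_ae_notMem]
    filter_upwards [hg] with x hx hxD
    rw [mem_iInter] at hxD
    obtain ⟨K₀, hK₀⟩ := hx (hxD 0).1 N
    obtain ⟨-, K, h1, h2⟩ := hxD K₀
    exact absurd (hK₀ K h1) (not_le.2 h2)
  have ht := tendsto_measure_iInter_atTop (μ := ν) (fun K => (hDm K).nullMeasurableSet) hDa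
    ⟨0, measure_ne_top _ _⟩
  rw [h0] at ht
  obtain ⟨K₀, hK₀⟩ := (ht.eventually_le_const (pos_iff_ne_zero.2 hε)).exists
  refine ⟨K₀, fun K hK => (measure_mono ?_).trans hK₀⟩
  rintro x ⟨h1, h2⟩
  exact ⟨h1, K, hK, h2⟩

lemma Ctx.color (X : Ctx ν C Neg I ρ U) {ι : Type} [Fintype ι] (Y : ι → Set ℝ)
    (hY : ∀ i, Y i ⊆ U) (ε : ENNReal) (hε : ε ≠ 0) :
    ∃ χ : I → Bool, ∀ i v, ν (hull ν Neg (Y i) \ hull ν Neg (Y i ∩ {p | χ (ρ p) = v})) ≤ ε := by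
  classical
  obtain ⟨b, hb⟩ := X.split
  have S := X.S
  have hε2 : ε / 2 ≠ 0 := (ENNReal.half_pos hε).ne'
  obtain ⟨N, hN⟩ : ∃ N : ℕ, 2 * Fintype.card ι * ν univ / 2 ^ N ≤ ε / 2 := by
    have h1 : Filter.Tendsto (fun N : ℕ => 2 * Fintype.card ι * ν univ * (2⁻¹ : ENNReal) ^ N)
        Filter.atTop (nhds 0) := by
      have := ENNReal.Tendsto.const_mul (a := 2 * Fintype.card ι * ν univ)
        (ENNReal.tendsto_pow_atTop_nhds_zero_of_lt_one (r := 2⁻¹) (by simp))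
        (Or.inr (by finiteness))
      simpa using this
    obtain ⟨N, hN⟩ := (h1.eventually_le_const (pos_iff_ne_zero.2 hε2)).exists
    refine ⟨N, ?_⟩
    rwa [div_eq_mul_inv, ENNReal.inv_pow]
  have hlev : ∀ i, ∃ K₀, ∀ K ≥ K₀, ν {x | x ∈ hull ν Neg (Y i) ∧
      (node ν Neg (fun p => b (ρ p)) (Y i) K x).card < N} ≤ ε / 2 := fun i =>
    S.level (fun p => b (ρ p)) (Y i) (fun Z hZ => hb Z (hZ.trans (hY i))) N _ hε2
  choose K₀ hK₀ using hlev
  set K := Finset.univ.sup K₀ with hKdef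
  have hK : ∀ i, ν {x | x ∈ hull ν Neg (Y i) ∧
      (node ν Neg (fun p => b (ρ p)) (Y i) K x).card < N} ≤ ε / 2 := fun i =>
    hK₀ i K (Finset.le_sup (Finset.mem_univ i))
  obtain ⟨l, hl⟩ := good_coloring ν (fun i x => node ν Neg (fun p => b (ρ p)) (Y i) K x)
    (fun i s => by simp only [mem_node]; exact S.hull_meas _) N
  refine ⟨fun i => l (pre K (b i)), fun i v => ?_⟩
  have hmono : ∀ᵐ x ∂ν, ∀ s, l s = v →
      x ∈ hull ν Neg (Y i ∩ {p | pre K (b (ρ p)) = s}) →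
      x ∈ hull ν Neg (Y i ∩ {p | l (pre K (b (ρ p))) = v}) := by
    simp only [ae_all_iff]; intro s hs
    refine S.hull_mono ?_
    rintro p ⟨hp, rfl⟩
    exact ⟨hp, hs⟩
  rw [ae_iff] at hmono
  have hbad : ν {x | N ≤ (node ν Neg (fun p => b (ρ p)) (Y i) K x).card ∧
      ∀ s ∈ node ν Neg (fun p => b (ρ p)) (Y i) K x, l s = !v} ≤ ε / 2 := by
    refine le_trans ?_ hN
    rw [ENNReal.le_div_iff_mul_le (by simp) (by simp)]
    exact hl i (!v)
  calc _ ≤ ν ({x | x ∈ hull ν Neg (Y i) ∧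
      (node ν Neg (fun p => b (ρ p)) (Y i) K x).card < N} ∪
      ({x | N ≤ (node ν Neg (fun p => b (ρ p)) (Y i) K x).card ∧
      ∀ s ∈ node ν Neg (fun p => b (ρ p)) (Y i) K x, l s = !v} ∪ _)) := measure_mono ?_
    _ ≤ ε / 2 + (ε / 2 + 0) := by
      refine (measure_union_le _ _).trans (add_le_add (hK i) ?_)
      exact (measure_union_le _ _).trans (add_le_add hbad hmono.le)
    _ = ε := by simp
  rintro x ⟨hx1, hx2⟩
  by_cases h1 : (node ν Neg (fun p => b (ρ p)) (Y i) K x).card < N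
  · exact Or.inl ⟨hx1, h1⟩
  · refine Or.inr ?_
    by_cases h2 : ∀ s ∈ node ν Neg (fun p => b (ρ p)) (Y i) K x, l s = !v
    · exact Or.inl ⟨not_lt.1 h1, h2⟩
    · right
      intro hh
      push Not at h2
      obtain ⟨s, hs, hsv⟩ := h2
      exact hx2 (hh s (by simpa using hsv) (mem_node.1 hs))

end

end GS

namespace GS

section

open MeasureTheory Set

variable {ν : Measure ℝ} [IsFiniteMeasure ν] {C : ℕ → Set ℝ} {Neg : Set ℝ → Prop}
  {I : Type} [LinearOrder I] {ρ : ℝ → I} {U : Set ℝ}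

lemma exists_rec {β : Type} [Inhabited β] (Q : (k : ℕ) → (ℕ → β) → β → Prop)
    (hQ : ∀ k h, ∃ y, Q k h y)
    (hloc : ∀ k h h' y, (∀ j < k, h j = h' j) → Q k h y → Q k h' y) :
    ∃ χ : ℕ → β, ∀ k, Q k χ (χ k) := by
  classical
  choose F hF using hQ
  let H : ℕ → ℕ → β := fun k => Nat.rec (fun _ => default)
    (fun k h => Function.update h k (F k h)) k
  have hH : ∀ k, H (k+1) = Function.update (H k) k (F k (H k)) := fun k => rfl
  have hst : ∀ k j, j < k → H k j = H (j+1) j := by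
    intro k
    induction k with
    | zero => intro j hj; omega
    | succ k ih =>
      intro j hj
      rcases Nat.lt_succ_iff_lt_or_eq.1 hj with h | rfl
      · rw [hH, Function.update_of_ne h.ne, ih j h]
      · rfl
  refine ⟨fun k => H (k+1) k, fun k => ?_⟩
  refine hloc k (H k) _ _ (fun j hj => hst k j hj) ?_
  simp only [hH, Function.update_self]
  exact hF k (H k)

lemma Ctx.seq (X : Ctx ν C Neg I ρ U) :
    ∃ c : I → ℕ → Bool, ∀ᵐ x ∂ν, ∀ n, ∃ k₀, ∀ k ≥ k₀, ∀ (s : Fin k → Bool) v,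
      x ∈ hull ν Neg (U ∩ C n ∩ {p | pre k (c (ρ p)) = s}) →
      x ∈ hull ν Neg (U ∩ C n ∩ {p | pre k (c (ρ p)) = s} ∩ {p | c (ρ p) k = v}) := by
  classical
  let ε : ℕ → ENNReal := fun k =>
    (2⁻¹ : ENNReal) ^ k / (Fintype.card ((Fin (k+1) × (Fin k → Bool)) × Bool) : ENNReal)
  have hε : ∀ k, ε k ≠ 0 := by
    intro k
    refine (ENNReal.div_pos ?_ (by finiteness)).ne'
    exact pow_ne_zero _ (by simp)
  obtain ⟨χ, hχ⟩ := exists_rec (β := I → Bool)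
    (fun k h y => ∀ (i : Fin (k+1) × (Fin k → Bool)) v,
      ν (hull ν Neg (U ∩ C i.1 ∩ {p | pre k (fun j => h j (ρ p)) = i.2}) \
        hull ν Neg (U ∩ C i.1 ∩ {p | pre k (fun j => h j (ρ p)) = i.2} ∩ {p | y (ρ p) = v})) ≤ ε k)
    (fun k h => X.color _ (fun i => inter_subset_left.trans inter_subset_left) _ (hε k))
    (by
      intro k h h' y hh hQ i v
      have : ∀ p : ℝ, pre k (fun j => h j (ρ p)) = pre k (fun j => h' j (ρ p)) := by
        intro p; funext j; simp only [pre]; rw [hh j j.2]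
      have := hQ i v
      simp_all only)
  refine ⟨fun i k => χ k i, ?_⟩
  let R : ℕ → Set ℝ := fun k => ⋃ i : (Fin (k+1) × (Fin k → Bool)) × Bool,
    (hull ν Neg (U ∩ C i.1.1 ∩ {p | pre k (fun j => χ j (ρ p)) = i.1.2}) \
        hull ν Neg (U ∩ C i.1.1 ∩ {p | pre k (fun j => χ j (ρ p)) = i.1.2} ∩
          {p | χ k (ρ p) = i.2}))
  have hR : ∀ k, ν (R k) ≤ 2⁻¹ ^ k := by
    intro k
    refine (measure_iUnion_fintype_le ν _).trans ?_
    refine (Finset.sum_le_sum fun i _ => hχ k i.1 i.2).trans ?_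
    rw [Finset.sum_const, Finset.card_univ, nsmul_eq_mul]
    exact ENNReal.mul_div_le
  have hsum : ∑' k, ν (R k) ≠ ⊤ := by
    refine ne_top_of_le_ne_top ?_ (ENNReal.tsum_le_tsum hR)
    rw [ENNReal.tsum_geometric]
    simp
  filter_upwards [ae_eventually_notMem hsum] with x hx n
  obtain ⟨k₀, hk₀⟩ := Filter.eventually_atTop.1 hx
  refine ⟨max k₀ n, fun k hk s v h1 => ?_⟩
  by_contra h2
  refine hk₀ k ((le_max_left _ _).trans hk) (mem_iUnion.2 ⟨⟨⟨⟨n, ?_⟩, s⟩, v⟩, h1, h2⟩)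
  exact Nat.lt_succ_of_le ((le_max_right _ _).trans hk)

/-- waiting time for the next `true` -/
noncomputable def wait (c : ℕ → Bool) (n : ℕ) : ℕ := sInf {t | c (n + t) = true}

lemma wait_eq {c : ℕ → Bool} {n t : ℕ} (h1 : c (n + t) = true) (h0 : ∀ u < t, c (n + u) = false) :
    wait c n = t := by
  apply le_antisymm
  · exact Nat.sInf_le h1
  · by_contra h
    push Not at h
    have : c (n + wait c n) = true := Nat.sInf_mem (s := {t | c (n + t) = true}) ⟨t, h1⟩
    rw [h0 _ h] at this
    cases this

lemma Ctx.guess (X : Ctx ν C Neg I ρ U) :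
    ∃ z : I → ℕ → ℕ, ∀ j : ℕ → ℕ, Neg {p | p ∈ U ∧ ∃ m, ∀ n ≥ m, z (ρ p) n ≠ j n} := by
  classical
  obtain ⟨c, hc⟩ := X.seq
  have S := X.S
  refine ⟨fun i => wait (c i), fun j => ?_⟩
  have : {p | p ∈ U ∧ ∃ m, ∀ n ≥ m, wait (c (ρ p)) n ≠ j n} =
      ⋃ m, {p | p ∈ U ∧ ∀ n ≥ m, wait (c (ρ p)) n ≠ j n} := by
    ext p; simp
  rw [this]
  refine S.iUnion _ fun m => ?_
  by_contra hneg
  set Y := {p | p ∈ U ∧ ∀ n ≥ m, wait (c (ρ p)) n ≠ j n} with hY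
  obtain ⟨n, E, hE, hpos, hsub⟩ := S.dense Y hneg
  -- the hull of `U ∩ C n` meets `E`
  have hpos2 : ν (hull ν Neg (U ∩ C n) ∩ E) ≠ 0 := by
    rw [Ne, ← S.hull_inter hE]
    intro h
    apply S.piece n E hE hpos
    refine S.mono ?_ (S.union h (S.null _ hsub))
    rintro p ⟨hp1, hp2⟩
    by_cases hpY : p ∈ Y
    · exact Or.inl ⟨⟨hpY.1, hp1⟩, hp2⟩
    · exact Or.inr ⟨⟨hp1, hp2⟩, hpY⟩
  let Good : Set (Σ K : ℕ, (Fin K → Bool)) := {q | ∃ k ≥ m, ∀ c' : ℕ → Bool,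
    pre q.1 c' = q.2 → wait c' k = j k}
  have hcov : ∀ᵐ x ∂ν, x ∈ hull ν Neg (U ∩ C n) → ∃ q ∈ Good,
      x ∈ hull ν Neg (U ∩ C n ∩ {p | pre q.1 (c (ρ p)) = q.2}) := by
    have hF0 : ∀ᵐ x ∂ν, ∀ K, x ∈ hull ν Neg (U ∩ C n) → ∃ s, True ∧
        x ∈ hull ν Neg (U ∩ C n ∩ {p | pre K (c (ρ p)) = s}) := by
      rw [ae_all_iff]; intro K
      exact S.refine_hull (fun p => pre K (c (ρ p))) (Subset.refl _) (fun _ => True) (by simp)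
    filter_upwards [hF0, hc] with x hF0 hc hx
    obtain ⟨k₀, hk₀⟩ := hc n
    set k := max k₀ m with hk
    obtain ⟨s, -, hs⟩ := hF0 k hx
    let σ : ℕ → Bool := fun t => if h : t < k then s ⟨t, h⟩ else decide (t = k + j k)
    have hσs : pre k σ = s := by
      funext t; simp [pre, σ]
    have hext : ∀ d, x ∈ hull ν Neg (U ∩ C n ∩ {p | pre (k + d) (c (ρ p)) = pre (k + d) σ}) := by
      intro d
      induction d with
      | zero => simpa [hσs] using hs
      | succ d ih =>
        have := hk₀ (k + d) ((le_max_left _ _).trans (Nat.le_add_right _ _)) _ (σ (k + d)) ih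
        convert this using 2
        ext p
        simp only [mem_inter_iff, mem_ofPred_eq, and_assoc]
        refine and_congr_right fun _ => and_congr_right fun _ => ?_
        constructor
        · intro h
          refine ⟨?_, ?_⟩
          · funext t
            exact congrFun h ⟨t, by omega⟩
          · exact congrFun h ⟨k + d, by omega⟩
        · rintro ⟨h1, h2⟩
          funext t
          by_cases ht : t.1 < k + d
          · exact congrFun h1 ⟨t, ht⟩
          · have : t.1 = k + d := by omega
            simp only [pre, this, h2]
    refine ⟨⟨k + (j k + 1), pre _ σ⟩, ⟨k, le_max_right _ _, fun c' hc' => ?_⟩, hext _⟩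
    have hc2 : ∀ t < k + (j k + 1), c' t = σ t := fun t ht => congrFun hc' ⟨t, ht⟩
    apply wait_eq
    · rw [hc2 _ (by omega)]
      simp [σ]
    · intro u hu
      rw [hc2 _ (by omega)]
      simp [σ]; omega
  obtain ⟨q, hq, hqpos⟩ : ∃ q ∈ Good,
      ν (hull ν Neg (U ∩ C n ∩ {p | pre q.1 (c (ρ p)) = q.2}) ∩ E) ≠ 0 := by
    by_contra hcon
    push Not at hcon
    apply hpos2
    have : ν (⋃ q : Good, hull ν Neg (U ∩ C n ∩ {p | pre q.1.1 (c (ρ p)) = q.1.2}) ∩ E) = 0 :=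
      measure_iUnion_null fun q => hcon q.1 q.2
    rw [measure_eq_zero_iff_ae_notMem] at this ⊢
    filter_upwards [this, hcov] with x h1 h2 hx
    obtain ⟨q, hq, hxq⟩ := h2 hx.1
    exact h1 (mem_iUnion.2 ⟨⟨q, hq⟩, hxq, hx.2⟩)
  rw [Ne, ← S.hull_inter hE] at hqpos
  apply hqpos
  refine S.mono ?_ (S.null _ hsub)
  rintro p ⟨⟨⟨hpU, hpC⟩, hpq⟩, hpE⟩
  refine ⟨⟨hpC, hpE⟩, fun hpY => ?_⟩
  obtain ⟨k, hk, hk2⟩ := hq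
  exact hpY.2 k hk (hk2 _ hpq)

end

end GS

namespace GS

section

open MeasureTheory Set

variable {ν : Measure ℝ} [IsFiniteMeasure ν] {C : ℕ → Set ℝ} {Neg : Set ℝ → Prop}
  {I : Type} [LinearOrder I] {ρ : ℝ → I} {U : Set ℝ}

lemma measurable_first (D : ℕ → Set ℝ) (hD : ∀ v, MeasurableSet (D v)) :
    Measurable fun x => sInf {v | x ∈ D v} := by
  refine measurable_to_countable' fun v => ?_
  have : (fun x => sInf {v | x ∈ D v}) ⁻¹' {v} =
      (D v ∩ ⋂ u, ⋂ (_ : u < v), (D u)ᶜ) ∪ ({x | v = 0} ∩ ⋂ u, (D u)ᶜ) := by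
    ext x
    simp only [mem_preimage, mem_singleton_iff, mem_union, mem_inter_iff, mem_iInter,
      mem_compl_iff, mem_ofPred_eq]
    constructor
    · rintro rfl
      by_cases h : ∃ u, x ∈ D u
      · exact Or.inl ⟨Nat.sInf_mem (s := {v | x ∈ D v}) h, fun u hu hx => Nat.notMem_of_lt_sInf hu hx⟩
      · push Not at h
        refine Or.inr ⟨?_, h⟩
        simp [h]
    · rintro (⟨h1, h2⟩ | ⟨rfl, h⟩)
      · apply le_antisymm (Nat.sInf_le h1)
        by_contra hlt
        push Not at hlt
        exact h2 _ hlt (Nat.sInf_mem (s := {v | x ∈ D v}) ⟨v, h1⟩)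
      · simp [h]
  rw [this]
  refine ((hD v).inter ?_).union ((MeasurableSet.const _).inter ?_)
  · exact MeasurableSet.iInter fun u => MeasurableSet.iInter fun _ => (hD u).compl
  · exact MeasurableSet.iInter fun u => (hD u).compl

lemma dense_functions (ν : Measure ℝ) [IsFiniteMeasure ν] :
    ∃ s : ℕ → ℝ → ℕ, (∀ j, Measurable (s j)) ∧ ∀ g : ℝ → ℕ, Measurable g → ∀ ε : ENNReal, ε ≠ 0 →
      ∃ j, ν {x | s j x ≠ g x} ≤ ε := by
  classical
  obtain ⟨𝒜, hc, hd⟩ := IsSeparable.exists_countable_measureDense (μ := ν)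
  have := hc.to_subtype
  let T := Σ M : ℕ, (Fin M → 𝒜)
  let DD : T → ℕ → Set ℝ := fun t v => if h : v < t.1 then (t.2 ⟨v, h⟩ : Set ℝ) else ∅
  have hDD : ∀ t v, MeasurableSet (DD t v) := by
    intro t v
    simp only [DD]
    split_ifs
    · exact hd.measurable _ (t.2 _).2
    · exact MeasurableSet.empty
  have : Nonempty T := ⟨⟨0, Fin.elim0⟩⟩
  obtain ⟨e, he⟩ := exists_surjective_nat T
  refine ⟨fun j x => sInf {v | x ∈ DD (e j) v}, fun j => measurable_first _ (hDD _), ?_⟩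
  intro g hg ε hε
  have hε2 : ε / 2 ≠ 0 := (ENNReal.half_pos hε).ne'
  obtain ⟨M, hM⟩ : ∃ M : ℕ, ν {x | M ≤ g x} ≤ ε / 2 := by
    have ht := tendsto_measure_iInter_atTop (μ := ν) (s := fun M : ℕ => {x | M ≤ g x})
      (fun M => (hg (measurableSet_Ici (a := M))).nullMeasurableSet)
      (fun M M' h x hx => le_trans h hx) ⟨0, measure_ne_top _ _⟩
    have h0 : (⋂ M : ℕ, {x | M ≤ g x}) = ∅ := by
      ext x
      simp only [mem_iInter, mem_ofPred_eq, mem_empty_iff_false, iff_false, not_forall, not_le]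
      exact ⟨g x + 1, Nat.lt_succ_self _⟩
    rw [h0, measure_empty] at ht
    exact (ht.eventually_le_const (pos_iff_ne_zero.2 hε2)).exists
  obtain ⟨δ, hδ0, hδ⟩ := ENNReal.lt_iff_exists_nnreal_btwn.1
    (ENNReal.div_pos hε2 (ENNReal.natCast_ne_top M))
  have hδpos : (0 : ℝ) < δ := by exact_mod_cast hδ0
  have happ : ∀ v : Fin M, ∃ t ∈ 𝒜, ν (symmDiff (g ⁻¹' {v.1}) t) < ENNReal.ofReal δ := fun v =>
    hd.approx _ (hg (measurableSet_singleton _)) (measure_ne_top _ _) δ hδpos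
  choose t ht1 ht2 using happ
  obtain ⟨j, hj⟩ := he ⟨M, fun v => ⟨t v, ht1 v⟩⟩
  refine ⟨j, ?_⟩
  simp only [hj]
  calc _ ≤ ν ({x | M ≤ g x} ∪ ⋃ v : Fin M, symmDiff (g ⁻¹' {v.1}) (t v)) := measure_mono ?_
    _ ≤ ε / 2 + ε / 2 := by
      refine (measure_union_le _ _).trans (add_le_add hM ?_)
      refine (measure_iUnion_fintype_le ν _).trans ?_
      refine (Finset.sum_le_sum fun v _ => (ht2 v).le).trans ?_
      rw [Finset.sum_const, Finset.card_univ, nsmul_eq_mul, Fintype.card_fin,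
        ENNReal.ofReal_coe_nnreal]
      refine le_trans ?_ (ENNReal.mul_div_le (a := (M : ENNReal)) (b := ε / 2))
      gcongr
    _ = ε := ENNReal.add_halves ε
  intro x hx
  by_contra hcon
  simp only [mem_union, mem_ofPred_eq, mem_iUnion, not_or, not_exists, not_le] at hcon
  obtain ⟨h1, h2⟩ := hcon
  apply hx
  have h3 : ∀ u, x ∈ DD ⟨M, fun v => ⟨t v, ht1 v⟩⟩ u ↔ u = g x := by
    intro u
    simp only [DD]
    split_ifs with h
    · have := h2 ⟨u, h⟩
      rw [mem_symmDiff] at this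
      simp only [mem_preimage, mem_singleton_iff] at this
      constructor
      · intro h4; by_contra h5; exact this (Or.inr ⟨h4, fun h6 => h5 h6.symm⟩)
      · intro h4; by_contra h5; exact this (Or.inl ⟨h4.symm, h5⟩)
    · simp only [mem_empty_iff_false, false_iff]
      rintro rfl; exact h h1
  simp [h3]

lemma null_freq (φ : ℕ → ℕ) : volume {x : ℝ | ∃ᶠ n in Filter.atTop, φ n = ⌊2 ^ n * |x|⌋₊} = 0 := by
  have hs : ∀ n, volume {x : ℝ | φ n = ⌊2 ^ n * |x|⌋₊} ≤ 2 * 2⁻¹ ^ n := by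
    intro n
    have hp : (0 : ℝ) < 2 ^ n := by positivity
    have hsub : {x : ℝ | φ n = ⌊2 ^ n * |x|⌋₊} ⊆ Icc (φ n / 2 ^ n : ℝ) ((φ n + 1) / 2 ^ n) ∪
        Icc (-((φ n + 1) / 2 ^ n) : ℝ) (-(φ n / 2 ^ n)) := by
      intro x hx
      have h1 := Nat.floor_le (show (0 : ℝ) ≤ 2 ^ n * |x| by positivity)
      have h2 := Nat.lt_floor_add_one (2 ^ n * |x| : ℝ)
      rw [← show φ n = ⌊2 ^ n * |x|⌋₊ from hx] at h1 h2
      have h3 : φ n / 2 ^ n ≤ |x| := by rw [div_le_iff₀ hp]; linarith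
      have h4 : |x| ≤ (φ n + 1) / 2 ^ n := by rw [le_div_iff₀ hp]; linarith
      rcases abs_cases x with ⟨h, -⟩ | ⟨h, -⟩ <;> rw [h] at h3 h4
      · exact Or.inl ⟨h3, h4⟩
      · exact Or.inr ⟨by linarith, by linarith⟩
    refine (measure_mono hsub).trans ((measure_union_le _ _).trans ?_)
    rw [Real.volume_Icc, Real.volume_Icc]
    have e1 : ((φ n : ℝ) + 1) / 2 ^ n - φ n / 2 ^ n = 2⁻¹ ^ n := by
      rw [inv_pow]; field_simp; ring
    have e2 : -((φ n : ℝ) / 2 ^ n) - -((φ n + 1) / 2 ^ n) = 2⁻¹ ^ n := by rw [← e1]; ring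
    rw [e1, e2, two_mul, ENNReal.ofReal_pow (by positivity), ENNReal.ofReal_inv_of_pos (by positivity)]
    simp
  have hsum : ∑' n, volume {x : ℝ | φ n = ⌊2 ^ n * |x|⌋₊} ≠ ⊤ := by
    refine ne_top_of_le_ne_top ?_ (ENNReal.tsum_le_tsum hs)
    rw [ENNReal.tsum_mul_left, ENNReal.tsum_geometric]
    simp [ENNReal.mul_eq_top]
  rw [measure_eq_zero_iff_ae_notMem]
  filter_upwards [ae_eventually_notMem hsum] with x hx hx2
  exact hx2 hx

lemma Ctx.false (X : Ctx ν C Neg I ρ U) : False := by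
  classical
  have S := X.S
  obtain ⟨z, hz⟩ := X.guess
  obtain ⟨s, hsm, hs⟩ := dense_functions ν
  let f : I → ℝ → ℕ → ℕ := fun i x n => s (z i n) x
  have hx : ∀ p : ℝ, ∃ x : ℝ, ∀ i < ρ p, ¬ ∃ᶠ n in Filter.atTop, f i p n = ⌊2 ^ n * |x|⌋₊ := by
    intro p
    have := X.small (ρ p) (fun i => {x : ℝ | ∃ᶠ n in Filter.atTop, f i p n = ⌊2 ^ n * |x|⌋₊})
      (fun i => S.null _ (X.ac (null_freq (f i p))))
    by_contra hcon
    push Not at hcon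
    apply X.pos
    refine S.mono ?_ this
    intro x _
    obtain ⟨i, hi, h⟩ := hcon x
    exact mem_iUnion₂.2 ⟨i, hi, h⟩
  choose xp hxp using hx
  let g : ℝ → ℕ → ℕ := fun p n => ⌊2 ^ n * |xp p|⌋₊
  have hg : ∀ i, Neg {p | p ∈ U ∧ ∃ᶠ n in Filter.atTop, f i p n = g p n} := by
    intro i
    refine S.mono ?_ (S.null _ (X.null i))
    rintro p ⟨hp, h⟩
    refine ⟨hp, ?_⟩
    by_contra hlt
    exact hxp p i (not_le.1 hlt) h
  let gs : ℕ → ℕ → ℝ → ℕ := fun l n x => sInf {v | x ∈ hull ν Neg (U ∩ C l ∩ {p | g p n = v})}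
  have hgs : ∀ l n, Measurable (gs l n) := fun l n => measurable_first _ fun v => S.hull_meas _
  choose j hj using fun l n => hs (gs l n) (hgs l n) (2⁻¹ ^ n) (pow_ne_zero _ (by simp))
  obtain ⟨i, hi⟩ : ∃ i, ∀ l, ∃ᶠ n in Filter.atTop, z i n = j l n := by
    by_contra hcon
    push Not at hcon
    apply X.pos
    refine S.mono ?_ (S.iUnion _ fun l => hz (j l))
    intro p hp
    obtain ⟨l, hl⟩ := hcon (ρ p)
    rw [Filter.eventually_atTop] at hl
    exact mem_iUnion.2 ⟨l, hp, hl⟩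
  have hfreq : ∀ l, ∀ᵐ x ∂ν, ∃ᶠ n in Filter.atTop, f i x n = gs l n x := by
    intro l
    have hsum : ∑' n, ν {x | s (j l n) x ≠ gs l n x} ≠ ⊤ := by
      refine ne_top_of_le_ne_top ?_ (ENNReal.tsum_le_tsum (hj l))
      rw [ENNReal.tsum_geometric]
      simp
    filter_upwards [ae_eventually_notMem hsum] with x hx
    refine ((hi l).and_eventually hx).mono ?_
    rintro n ⟨h1, h2⟩
    simp only [f, h1]
    by_contra h3
    exact h2 h3
  -- find a level
  obtain ⟨m, hm⟩ : ∃ m, ¬ Neg {p | p ∈ U ∧ ∀ n ≥ m, f i p n ≠ g p n} := by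
    by_contra hcon
    push Not at hcon
    apply X.pos
    refine S.mono ?_ (S.union (hg i) (S.iUnion _ hcon))
    intro p hp
    by_cases h : ∃ᶠ n in Filter.atTop, f i p n = g p n
    · exact Or.inl ⟨hp, h⟩
    · rw [Filter.not_frequently, Filter.eventually_atTop] at h
      obtain ⟨m, hm⟩ := h
      exact Or.inr (mem_iUnion.2 ⟨m, hp, hm⟩)
  set Y := {p | p ∈ U ∧ ∀ n ≥ m, f i p n ≠ g p n} with hY
  obtain ⟨l, E, hE, hpos, hsub⟩ := S.dense Y hm
  have hpos2 : ν (hull ν Neg (U ∩ C l) ∩ E) ≠ 0 := by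
    rw [Ne, ← S.hull_inter hE]
    intro h
    apply S.piece l E hE hpos
    refine S.mono ?_ (S.union h (S.null _ hsub))
    rintro p ⟨hp1, hp2⟩
    by_cases hpY : p ∈ Y
    · exact Or.inl ⟨⟨hpY.1, hp1⟩, hp2⟩
    · exact Or.inr ⟨⟨hp1, hp2⟩, hpY⟩
  have hF0 : ∀ᵐ x ∂ν, ∀ n, x ∈ hull ν Neg (U ∩ C l) → ∃ v, True ∧
      x ∈ hull ν Neg (U ∩ C l ∩ {p | g p n = v}) := by
    rw [ae_all_iff]; intro n
    exact S.refine_hull (fun p => g p n) (Subset.refl _) (fun _ => True) (by simp)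
  have hEm : ∀ n v, MeasurableSet (E ∩ {x | f i x n = v}) := fun n v =>
    hE.inter (hsm _ (measurableSet_singleton v))
  apply hpos2
  have hnull : ν (⋃ q : {n // n ≥ m} × ℕ, hull ν Neg (U ∩ C l ∩ {p | g p q.1 = q.2}) ∩
      (E ∩ {x | f i x q.1 = q.2})) = 0 := by
    refine measure_iUnion_null fun q => ?_
    rw [← S.hull_inter (hEm _ _)]
    refine S.mono ?_ (S.null _ hsub)
    rintro p ⟨⟨⟨hpU, hpC⟩, hpq⟩, hpE, hpf⟩
    refine ⟨⟨hpC, hpE⟩, fun hpY => ?_⟩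
    refine hpY.2 q.1 q.1.2 ?_
    rw [show f i p q.1 = q.2 from hpf, show g p q.1 = q.2 from hpq]
  rw [measure_eq_zero_iff_ae_notMem] at hnull ⊢
  filter_upwards [hnull, hF0, hfreq l] with x h1 h2 h3 hx
  obtain ⟨n, hn, hfn⟩ := Filter.frequently_atTop.1 h3 m
  obtain ⟨v, -, hv⟩ := h2 n hx.1
  exact h1 (mem_iUnion.2 ⟨(⟨n, hn⟩, gs l n x),
    Nat.sInf_mem (s := {v | x ∈ hull ν Neg (U ∩ C l ∩ {p | g p n = v})}) ⟨v, hv⟩, hx.2, hfn⟩)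

theorem Sys.neg_univ (hν : ν ≪ volume) (S : Sys ν C Neg) : Neg univ := by
  by_contra h
  obtain ⟨I, _, ρ, U, h1, h2, h3⟩ := S.chain hν h
  exact Ctx.false (ν := ν) (C := C) (Neg := Neg) (I := I) (ρ := ρ) (U := U) ⟨S, hν, h1, h2, h3⟩

end

end GS

namespace GS

section

open MeasureTheory Set

/-- `B` splits every positive piece of `Q` -/
def Splits (ν : Measure ℝ) (a : ℕ → Set ℝ) (B Q : Set ℝ) : Prop :=
  ∀ m E, MeasurableSet E → ν (Q ∩ a m ∩ E) ≠ 0 →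
    ν (Q ∩ a m ∩ E ∩ B) ≠ 0 ∧ ν ((Q ∩ a m ∩ E) \ B) ≠ 0

/-- a countable algebra of sets, enumerated -/
structure Alg (a : ℕ → Set ℝ) : Prop where
  compl : ∀ m, ∃ k, a k = (a m)ᶜ
  inter : ∀ m n, ∃ k, a k = a m ∩ a n

lemma Alg.univ {a : ℕ → Set ℝ} (h : Alg a) : ∃ k, a k = univ := by
  obtain ⟨k, hk⟩ := h.compl 0
  obtain ⟨l, hl⟩ := h.inter 0 k
  obtain ⟨m, hm⟩ := h.compl l
  exact ⟨m, by rw [hm, hl, hk]; simp⟩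

variable {ν : Measure ℝ} {a : ℕ → Set ℝ} {B Q : Set ℝ}

lemma Splits.restr (h : Alg a) (hs : Splits ν a B Q) (k : ℕ) {E : Set ℝ} (hE : MeasurableSet E) :
    Splits ν a B (Q ∩ a k ∩ E) := by
  intro m E' hE' hpos
  obtain ⟨r, hr⟩ := h.inter k m
  have : Q ∩ a k ∩ E ∩ a m ∩ E' = Q ∩ a r ∩ (E ∩ E') := by
    rw [hr]; ext x; simp only [mem_inter_iff]; tauto
  rw [this] at hpos ⊢
  exact hs r _ (hE.inter hE') hpos

lemma Splits.iUnion {ι : Type} [Countable ι] (Q : ι → Set ℝ) (hs : ∀ i, Splits ν a B (Q i)) :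
    Splits ν a B (⋃ i, Q i) := by
  intro m E hE hpos
  obtain ⟨i, hi⟩ : ∃ i, ν (Q i ∩ a m ∩ E) ≠ 0 := by
    by_contra hcon
    push Not at hcon
    apply hpos
    rw [iUnion_inter, iUnion_inter]
    exact measure_iUnion_null hcon
  have hsub : Q i ∩ a m ∩ E ⊆ (⋃ i, Q i) ∩ a m ∩ E := by
    gcongr; exact subset_iUnion Q i
  obtain ⟨h1, h2⟩ := hs i m E hE hi
  exact ⟨fun h => h1 (measure_mono_null (inter_subset_inter_left _ hsub) h),
    fun h => h2 (measure_mono_null (sdiff_subset_sdiff_left hsub) h)⟩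

lemma Splits.congr {B' : Set ℝ} (hs : Splits ν a B Q) (h : ∀ x ∈ Q, x ∈ B ↔ x ∈ B') :
    Splits ν a B' Q := by
  intro m E hE hpos
  have h1 : Q ∩ a m ∩ E ∩ B' = Q ∩ a m ∩ E ∩ B := by
    ext x; simp only [mem_inter_iff]
    exact and_congr_right fun hx => (h x hx.1.1).symm
  have h2 : (Q ∩ a m ∩ E) \ B' = (Q ∩ a m ∩ E) \ B := by
    ext x; simp only [mem_inter_iff, mem_sdiff]
    exact and_congr_right fun hx => not_congr (h x hx.1.1).symm
  rw [h1, h2]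
  exact hs m E hE hpos

lemma Splits.diff (h : Alg a) (hs : Splits ν a B Q) (k : ℕ) {E : Set ℝ} (hE : MeasurableSet E) :
    Splits ν a B (Q \ (a k ∩ E)) := by
  obtain ⟨k', hk'⟩ := h.compl k
  have h1 := hs.restr h k' MeasurableSet.univ
  have h2 := hs.restr h k hE.compl
  have : Q \ (a k ∩ E) = ⋃ b : Bool, cond b (Q ∩ a k' ∩ Set.univ) (Q ∩ a k ∩ Eᶜ) := by
    rw [← union_eq_iUnion, hk']
    ext x; simp only [mem_union, mem_inter_iff, mem_sdiff, mem_compl_iff, mem_univ]; tauto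
  rw [this]
  refine Splits.iUnion _ ?_
  rintro (_|_)
  · exact h2
  · exact h1

lemma spl_iUnion (h : Alg a) (k : ℕ → ℕ) (E : ℕ → Set ℝ) (hE : ∀ i, MeasurableSet (E i))
    (hs : ∀ i, ∃ B, Splits ν a B (a (k i) ∩ E i)) :
    ∃ B, Splits ν a B (⋃ i, a (k i) ∩ E i) := by
  classical
  choose B hB using hs
  let Q : ℕ → Set ℝ := fun i => a (k i) ∩ E i
  let Q' : ℕ → ℕ → Set ℝ := fun i j => {x | x ∈ Q i ∧ ∀ l < j, x ∉ Q l}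
  have hQ' : ∀ i j, Splits ν a (B i) (Q' i j) := by
    intro i j
    induction j with
    | zero =>
      have : Q' i 0 = Q i := by ext x; simp [Q']
      rw [this]; exact hB i
    | succ j ih =>
      have : Q' i (j+1) = Q' i j \ (a (k j) ∩ E j) := by
        ext x
        constructor
        · rintro ⟨h1, h2⟩
          exact ⟨⟨h1, fun l hl => h2 l (by omega)⟩, h2 j (by omega)⟩
        · rintro ⟨⟨h1, h2⟩, h3⟩
          refine ⟨h1, fun l hl => ?_⟩
          rcases Nat.lt_succ_iff_lt_or_eq.1 hl with h | rfl
          · exact h2 l h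
          · exact h3
      rw [this]
      exact ih.diff h (k j) (hE j)
  have hun : (⋃ i, a (k i) ∩ E i) = ⋃ i, Q' i i := by
    ext x
    simp only [mem_iUnion]
    constructor
    · intro hx
      exact ⟨Nat.find hx, Nat.find_spec hx, fun l hl => Nat.find_min hx hl⟩
    · rintro ⟨i, hi⟩; exact ⟨i, hi.1⟩
  rw [hun]
  refine ⟨⋃ i, B i ∩ Q' i i, Splits.iUnion _ fun i => (hQ' i i).congr ?_⟩
  intro x hx
  constructor
  · intro hb; exact mem_iUnion.2 ⟨i, hb, hx⟩
  · intro hb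
    obtain ⟨i', hb1, hb2⟩ := mem_iUnion.1 hb
    have : i' = i := by
      rcases lt_trichotomy i' i with h | h | h
      · exact absurd hb2.1 (hx.2 _ h)
      · exact h
      · exact absurd hx.1 (hb2.2 _ h)
    rw [← this]; exact hb1

/-- negligible sets relative to a family of pieces -/
def NegR (ν : Measure ℝ) (C : ℕ → Set ℝ) (Y : Set ℝ) : Prop :=
  ∀ n E, MeasurableSet E → ν (C n ∩ E) ≠ 0 → ν ((C n ∩ E) \ Y) ≠ 0

variable [IsFiniteMeasure ν] {P : Set ℝ}

lemma NegR.union (ha : Alg a)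
    (hP : ∀ n E, MeasurableSet E → ν (P ∩ a n ∩ E) ≠ 0 → ¬ ∃ B, Splits ν a B (P ∩ a n ∩ E))
    {Y Z : Set ℝ} (hY : NegR ν (fun n => P ∩ a n) Y) (hZ : NegR ν (fun n => P ∩ a n) Z) :
    NegR ν (fun n => P ∩ a n) (Y ∪ Z) := by
  intro n E hE hpos h0
  have hns := hP n E hE hpos
  push Not at hns
  have := hns Y
  unfold Splits at this
  push Not at this
  obtain ⟨m, E', hE', hpos', himp⟩ := this
  obtain ⟨r, hr⟩ := ha.inter n m
  have he : P ∩ a n ∩ E ∩ a m ∩ E' = P ∩ a r ∩ (E ∩ E') := by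
    rw [hr]; ext x; simp only [mem_inter_iff]; tauto
  rw [he] at hpos' himp
  by_cases h1 : ν (P ∩ a r ∩ (E ∩ E') ∩ Y) = 0
  · refine hZ r _ (hE.inter hE') hpos' (measure_mono_null ?_ (measure_union_null h1 h0))
    rintro x ⟨hx1, hx2⟩
    by_cases hxY : x ∈ Y
    · exact Or.inl ⟨hx1, hxY⟩
    · refine Or.inr ⟨⟨?_, hx1.2.1⟩, by rintro (h | h); exacts [hxY h, hx2 h]⟩
      have : x ∈ P ∩ a r := hx1.1
      rw [hr] at this
      exact ⟨this.1, this.2.1⟩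
  · exact hY r _ (hE.inter hE') hpos' (himp h1)

/-- sets with large layers can be split -/
lemma layers (Q : Set ℝ) (Y : ℕ → Set ℝ) (hmono : Monotone Y)
    (hcov : ν (Q \ ⋃ k, Y k) = 0) (hfull : ∀ k n, ν ((Q ∩ a n) \ Y k) = ν (Q ∩ a n)) :
    ∃ B, Splits ν a B Q := by
  classical
  have step : ∀ i k : ℕ, ∃ k', k ≤ k' ∧ ∀ n ≤ i,
      ν (Q ∩ a n) ≤ ν (Q ∩ a n ∩ (Y k' \ Y k)) + 2⁻¹ ^ i := by
    intro i k
    have hε : (2⁻¹ : ENNReal) ^ i ≠ 0 := pow_ne_zero _ (by simp)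
    have hev : ∀ n, ∀ᶠ k' in Filter.atTop,
        ν (Q ∩ a n) ≤ ν (Q ∩ a n ∩ (Y k' \ Y k)) + 2⁻¹ ^ i := by
      intro n
      have hm : Monotone fun k' => Q ∩ a n ∩ (Y k' \ Y k) := by
        intro k1 k2 h12 x hx
        exact ⟨hx.1, hmono h12 hx.2.1, hx.2.2⟩
      have ht := tendsto_measure_iUnion_atTop (μ := ν) hm
      have hle : ν (Q ∩ a n) ≤ ν (⋃ k', Q ∩ a n ∩ (Y k' \ Y k)) := by
        rw [← hfull k n]
        refine (measure_mono (t := (⋃ k', Q ∩ a n ∩ (Y k' \ Y k)) ∪ (Q \ ⋃ k, Y k)) ?_).trans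
          ((measure_union_le _ _).trans (by rw [hcov, add_zero]))
        rintro x ⟨hx1, hx2⟩
        by_cases hx : x ∈ ⋃ k, Y k
        · obtain ⟨k', hk'⟩ := mem_iUnion.1 hx
          exact Or.inl (mem_iUnion.2 ⟨k', hx1, hk', hx2⟩)
        · exact Or.inr ⟨hx1.1, hx⟩
      have ht2 := ht.add_const ((2⁻¹ : ENNReal) ^ i)
      refine (ht2.eventually_const_lt ?_).mono fun k' h => h.le
      exact (ENNReal.lt_add_right (measure_ne_top _ _) hε).trans_le (by gcongr)
    have hall : ∀ᶠ k' in Filter.atTop, ∀ n ∈ Finset.range (i+1),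
        ν (Q ∩ a n) ≤ ν (Q ∩ a n ∩ (Y k' \ Y k)) + 2⁻¹ ^ i :=
      (Filter.eventually_all_finset _).2 fun n _ => hev n
    obtain ⟨k', h1, h2⟩ := (hall.and (Filter.eventually_ge_atTop k)).exists
    exact ⟨k', h2, fun n hn => h1 n (Finset.mem_range.2 (by omega))⟩
  choose F hF1 hF2 using step
  let κ : ℕ → ℕ := fun i => Nat.rec 0 (fun i k => F i k) i
  have hκ : ∀ i, κ (i+1) = F i (κ i) := fun i => rfl
  have hκm : Monotone κ := monotone_nat_of_le_succ fun i => by rw [hκ]; exact hF1 _ _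
  let L : ℕ → Set ℝ := fun i => Y (κ (i+1)) \ Y (κ i)
  have hdisj : ∀ i i' x, x ∈ L i → x ∈ L i' → i = i' := by
    have : ∀ i i' x, i < i' → x ∈ L i → x ∉ L i' := by
      intro i i' x hlt h1 h2
      exact h2.2 (hmono (hκm hlt) h1.1)
    intro i i' x h1 h2
    rcases lt_trichotomy i i' with h | h | h
    · exact absurd h2 (this _ _ _ h h1)
    · exact h
    · exact absurd h1 (this _ _ _ h h2)
  have hbig : ∀ n E, MeasurableSet E → ν (Q ∩ a n ∩ E) ≠ 0 →
      ∃ i₀, ∀ i ≥ i₀, ν (Q ∩ a n ∩ E ∩ L i) ≠ 0 := by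
    intro n E hE hpos
    have hev := (ENNReal.tendsto_pow_atTop_nhds_zero_of_lt_one (r := 2⁻¹) (by simp)).eventually_lt_const
      (pos_iff_ne_zero.2 hpos)
    obtain ⟨i₀, hi₀⟩ := Filter.eventually_atTop.1 hev
    refine ⟨max i₀ n, fun i hi h0 => ?_⟩
    have h1 := hF2 i (κ i) n ((le_max_right _ _).trans hi)
    rw [← hκ] at h1
    have h2 := hi₀ i ((le_max_left _ _).trans hi)
    rw [← measure_inter_add_sdiff (Q ∩ a n) hE,
      ← measure_inter_add_sdiff (Q ∩ a n ∩ (Y (κ (i+1)) \ Y (κ i))) hE] at h1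
    have h3 : ν (Q ∩ a n ∩ (Y (κ (i+1)) \ Y (κ i)) ∩ E) = 0 := by
      rw [inter_right_comm]; exact h0
    rw [h3, zero_add] at h1
    have h4 : ν ((Q ∩ a n ∩ (Y (κ (i+1)) \ Y (κ i))) \ E) ≤ ν ((Q ∩ a n) \ E) :=
      measure_mono (sdiff_subset_sdiff_left inter_subset_left)
    have h5 := h1.trans (add_le_add_left h4 _)
    rw [add_comm] at h5
    have h6 := (ENNReal.add_le_add_iff_left (measure_ne_top ν _)).1 h5
    exact absurd h2 (not_lt.2 h6)
  refine ⟨⋃ i, L (2 * i), fun n E hE hpos => ?_⟩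
  obtain ⟨i₀, hi₀⟩ := hbig n E hE hpos
  constructor
  · intro h
    refine hi₀ (2 * i₀) (by omega) (measure_mono_null ?_ h)
    exact inter_subset_inter_right _ (subset_iUnion (fun i => L (2 * i)) i₀)
  · intro h
    refine hi₀ (2 * i₀ + 1) (by omega) (measure_mono_null ?_ h)
    rintro x ⟨hx1, hx2⟩
    refine ⟨hx1, fun hx3 => ?_⟩
    obtain ⟨i, hi⟩ := mem_iUnion.1 hx3
    have := hdisj _ _ _ hx2 hi
    omega

lemma NegR.iUnion (ha : Alg a)
    (hP : ∀ n E, MeasurableSet E → ν (P ∩ a n ∩ E) ≠ 0 → ¬ ∃ B, Splits ν a B (P ∩ a n ∩ E))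
    (f : ℕ → Set ℝ) (hf : ∀ k, NegR ν (fun n => P ∩ a n) (f k)) :
    NegR ν (fun n => P ∩ a n) (⋃ k, f k) := by
  intro n₀ E₀ hE₀ hpos h0
  have hY : ∀ k, NegR ν (fun n => P ∩ a n) (accumulate f k) := by
    intro k
    induction k with
    | zero => simpa [accumulate] using hf 0
    | succ k ih => rw [accumulate_succ]; exact NegR.union ha hP ih (hf _)
  refine hP n₀ E₀ hE₀ hpos (layers _ (accumulate f) monotone_accumulate
    (by rw [iUnion_accumulate]; exact h0) ?_)
  intro k n
  refine le_antisymm (measure_mono sdiff_subset) ?_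
  obtain ⟨r, hr⟩ := ha.inter n₀ n
  have he : ∀ E, P ∩ a n₀ ∩ E₀ ∩ a n ∩ E = P ∩ a r ∩ (E₀ ∩ E) := by
    intro E
    rw [hr]; ext x; simp only [mem_inter_iff]; tauto
  set H := toMeasurable ν ((P ∩ a n₀ ∩ E₀ ∩ a n) \ accumulate f k) with hH
  have hHm : MeasurableSet H := measurableSet_toMeasurable _ _
  have h1 : ν (P ∩ a n₀ ∩ E₀ ∩ a n ∩ Hᶜ) = 0 := by
    rw [he]
    by_contra hne
    refine hY k r _ (hE₀.inter hHm.compl) hne ?_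
    show ν ((P ∩ a r ∩ (E₀ ∩ Hᶜ)) \ accumulate f k) = 0
    rw [← he]
    convert measure_empty (μ := ν)
    rw [eq_empty_iff_forall_notMem]
    rintro x ⟨⟨hx1, hx2⟩, hx3⟩
    exact hx2 (subset_toMeasurable ν _ ⟨hx1, hx3⟩)
  calc ν (P ∩ a n₀ ∩ E₀ ∩ a n) ≤ ν (H ∪ P ∩ a n₀ ∩ E₀ ∩ a n ∩ Hᶜ) := by
        refine measure_mono fun x hx => ?_
        by_cases hxH : x ∈ H
        · exact Or.inl hxH
        · exact Or.inr ⟨hx, hxH⟩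
    _ ≤ ν H + 0 := (measure_union_le _ _).trans (by rw [h1])
    _ = _ := by rw [add_zero, hH, measure_toMeasurable]

/-- the splitting theorem for algebras -/
theorem split_alg (hν : ν ≪ volume) (ha : Alg a) : ∃ B, Splits ν a B univ := by
  classical
  have hex : ∀ m, ∃ E, MeasurableSet E ∧ (∃ B, Splits ν a B (a m ∩ E)) ∧
      ∀ E', MeasurableSet E' → (∃ B, Splits ν a B (a m ∩ E')) → ν (E' \ E) = 0 := by
    intro m
    refine exhaust ν (fun E => ∃ B, Splits ν a B (a m ∩ E)) ⟨∅, ?_⟩ ?_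
    · intro k E _ h; simp at h
    · intro f hf hs
      have := spl_iUnion ha (fun _ => m) f hf hs
      rwa [← inter_iUnion] at this
  choose E hEm hEs hEmax using hex
  obtain ⟨B, hB⟩ := spl_iUnion ha (fun m => m) E hEm hEs
  set D := ⋃ m, a m ∩ E m with hD
  by_cases hcase : ∀ m F, MeasurableSet F → ν (a m ∩ F) ≠ 0 → ν (D ∩ a m ∩ F) ≠ 0
  · refine ⟨B, fun m F hF hpos => ?_⟩
    rw [univ_inter] at hpos ⊢
    obtain ⟨h1, h2⟩ := hB m F hF (hcase m F hF hpos)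
    have hsub : D ∩ a m ∩ F ⊆ a m ∩ F := inter_subset_inter_left _ inter_subset_right
    exact ⟨fun h => h1 (measure_mono_null (inter_subset_inter_left _ hsub) h),
      fun h => h2 (measure_mono_null (sdiff_subset_sdiff_left hsub) h)⟩
  · exfalso
    push Not at hcase
    obtain ⟨m₀, F₀, hF₀, hpos₀, hz₀⟩ := hcase
    set P := a m₀ ∩ F₀ with hPdef
    have hP : ∀ n F, MeasurableSet F → ν (P ∩ a n ∩ F) ≠ 0 →
        ¬ ∃ B, Splits ν a B (P ∩ a n ∩ F) := by
      intro n F hF hpos hs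
      obtain ⟨r, hr⟩ := ha.inter m₀ n
      have he : P ∩ a n ∩ F = a r ∩ (F₀ ∩ F) := by
        rw [hr, hPdef]; ext x; simp only [mem_inter_iff]; tauto
      rw [he] at hs
      have h1 := hEmax r _ (hF₀.inter hF) hs
      apply hpos
      refine measure_mono_null ?_ (measure_union_null h1 hz₀)
      intro x hx
      have hx' := hx
      rw [he] at hx'
      by_cases hxE : x ∈ E r
      · exact Or.inr ⟨⟨mem_iUnion.2 ⟨r, hx'.1, hxE⟩, hx.1.1.1⟩, hx.1.1.2⟩
      · exact Or.inl ⟨hx'.2, hxE⟩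
    have S : Sys ν (fun n => P ∩ a n) (NegR ν (fun n => P ∩ a n)) := by
      refine ⟨?_, ?_, ?_, ?_, ?_⟩
      · intro A B hAB hB n F hF hpos h
        exact hB n F hF hpos (measure_mono_null (sdiff_subset_sdiff_right hAB) h)
      · exact fun f hf => NegR.iUnion ha hP f hf
      · intro A hA n F hF hpos h
        rw [measure_sdiff_null hA] at h
        exact hpos h
      · intro Y hY
        unfold NegR at hY
        push Not at hY
        exact hY
      · intro n F hF hpos h
        exact h n F hF hpos (by simp)
    obtain ⟨u, hu⟩ := ha.univ
    refine S.neg_univ hν u univ MeasurableSet.univ ?_ (by simp)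
    simpa [hu] using hpos₀

theorem split_family (A : ℕ → Set ℝ) : ∃ B, ∀ n E, MeasurableSet E → volume (A n ∩ E) ≠ 0 →
    volume (A n ∩ E ∩ B) ≠ 0 ∧ volume ((A n ∩ E) \ B) ≠ 0 := by
  have hcount : (generateSetAlgebra (range A)).Countable :=
    countable_generateSetAlgebra (countable_range A)
  have halg := isSetAlgebra_generateSetAlgebra (𝒜 := range A)
  obtain ⟨a, hrange⟩ := hcount.exists_eq_range ⟨∅, halg.empty_mem⟩
  have hmem : ∀ m, a m ∈ generateSetAlgebra (range A) := fun m => hrange ▸ mem_range_self m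
  have ha : Alg a := by
    constructor
    · intro m
      have : (a m)ᶜ ∈ range a := hrange ▸ halg.compl_mem (hmem m)
      exact this
    · intro m n
      have : a m ∩ a n ∈ range a := hrange ▸ halg.inter_mem (hmem m) (hmem n)
      exact this
  have h0 : ∀ s : Set ℝ, (volume : Measure ℝ).toFinite s = 0 ↔ volume s = 0 := fun s =>
    ⟨fun h => absolutelyContinuous_toFinite _ h, fun h => toFinite_absolutelyContinuous _ h⟩
  obtain ⟨B, hB⟩ := split_alg (ν := (volume : Measure ℝ).toFinite)
    (toFinite_absolutelyContinuous _) ha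
  refine ⟨B, fun n E hE hpos => ?_⟩
  obtain ⟨m, hm⟩ : A n ∈ range a := hrange ▸ self_subset_generateSetAlgebra (mem_range_self n)
  have := hB m E hE (by rw [univ_inter, hm, Ne, h0]; exact hpos)
  rwa [univ_inter, hm, Ne, Ne, h0, h0] at this

theorem main (A : ℕ → Set ℝ) :
    ∃ B : ℕ → Set ℝ, (∀ n, B n ⊆ A n) ∧ Pairwise (Function.onFun Disjoint B) ∧
      ∀ n, volume (B n) = volume (A n) := by
  classical
  choose T hT using split_family
  let R : ℕ → Set ℝ := fun i => Nat.rec univ (fun _ R => R \ T (fun n => A n ∩ R)) i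
  have hR : ∀ i, R (i+1) = R i \ T (fun n => A n ∩ R i) := fun i => rfl
  have hRa : Antitone R := antitone_nat_of_succ_le fun i => by rw [hR]; exact sdiff_subset
  have hfull : ∀ i n E, MeasurableSet E → volume (A n ∩ E) ≠ 0 → volume (A n ∩ R i ∩ E) ≠ 0 := by
    intro i
    induction i with
    | zero => intro n E _ h; simpa [R] using h
    | succ i ih =>
      intro n E hE h h0
      refine (hT (fun n => A n ∩ R i) n E hE (ih n E hE h)).2 (measure_mono_null ?_ h0)
      rintro x ⟨⟨⟨h1, h2⟩, h3⟩, h4⟩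
      exact ⟨⟨h1, h2, h4⟩, h3⟩
  refine ⟨fun n => A n ∩ R n ∩ T (fun m => A m ∩ R n), fun n x hx => hx.1.1, ?_, fun n => ?_⟩
  · have key : ∀ i j, i < j → Disjoint (A i ∩ R i ∩ T (fun m => A m ∩ R i))
        (A j ∩ R j ∩ T (fun m => A m ∩ R j)) := by
      intro i j hij
      rw [Set.disjoint_left]
      intro x hx hy
      have h1 : x ∈ R (i+1) := hRa hij hy.1.2
      rw [hR] at h1
      exact h1.2 hx.2
    intro i j hij
    rcases lt_or_gt_of_ne hij with h | h
    · exact key i j h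
    · exact (key j i h).symm
  · set Bn := A n ∩ R n ∩ T (fun m => A m ∩ R n) with hBn
    refine le_antisymm (measure_mono fun x hx => hx.1.1) ?_
    set H := toMeasurable volume Bn with hH
    have hHm : MeasurableSet H := measurableSet_toMeasurable _ _
    have h1 : volume (A n ∩ Hᶜ) = 0 := by
      by_contra hne
      refine (hT (fun m => A m ∩ R n) n Hᶜ hHm.compl (hfull n n _ hHm.compl hne)).1 ?_
      convert measure_empty (μ := (volume : Measure ℝ))
      rw [eq_empty_iff_forall_notMem]
      rintro x ⟨⟨hx1, hx2⟩, hx3⟩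
      exact hx2 (subset_toMeasurable volume _ ⟨hx1, hx3⟩)
    calc volume (A n) ≤ volume (H ∪ A n ∩ Hᶜ) := by
          refine measure_mono fun x hx => ?_
          by_cases hxH : x ∈ H
          · exact Or.inl hxH
          · exact Or.inr ⟨hx, hxH⟩
      _ ≤ volume H + 0 := (measure_union_le _ _).trans (by rw [h1])
      _ = volume Bn := by rw [add_zero, hH, measure_toMeasurable]

end

end GS

/-- Gitik–Shelah: given sets `A n ⊆ ℝ` for `n < ω`, one can find pairwise disjoint
sets `B n ⊆ A n` such that `A n` and `B n` have the same Lebesgue outer measure. -/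
theorem gitik_shelah_refinement (A : ℕ → Set ℝ) :
    ∃ B : ℕ → Set ℝ, (∀ n, B n ⊆ A n) ∧ Pairwise (Function.onFun Disjoint B) ∧
      ∀ n, volume (B n) = volume (A n) := by
  exact GS.main A
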